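/- arXiv:1708.09306 — 4 statements merged into one kernel-verified Lean document; each statement's English description precedes it below -/
import Mathlib

section
/- Let n ≥ 3 and l ≥ 1 be integers and p ∈ (1, n/(2l)). Then for every f ∈ C_c^∞(B), ∫_B |f(x)|^p / ( |x|^n (log(1/|x|))^p ) dx ≤ ( (p/(p−1)) · (2^{1−l}/(l−1)!) · ∏_{i=0}^{l−1} 1/(n−2i−2) )^p ∫_B |Δ_r^l f(x)|^p / |x|^{n−2lp} dx. -/
open MeasureTheory

/-- The radial derivative `∂_r f (x) = ⟨x/|x|, ∇f(x)⟩` of `f : ℝⁿ → ℝ`. -/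
noncomputable def radDeriv {n : ℕ} (f : EuclideanSpace ℝ (Fin n) → ℝ)
    (x : EuclideanSpace ℝ (Fin n)) : ℝ :=
  fderiv ℝ f x (‖x‖⁻¹ • x)

/-- The radial Laplacian `Δ_r f = ∂_r² f + ((n-1)/|x|) ∂_r f`. -/
noncomputable def radLap {n : ℕ} (f : EuclideanSpace ℝ (Fin n) → ℝ)
    (x : EuclideanSpace ℝ (Fin n)) : ℝ :=
  radDeriv (radDeriv f) x + ((n : ℝ) - 1) / ‖x‖ * radDeriv f x

lemma abs_rpow_tangent {p : ℝ} (hp : 1 < p) (a b : ℝ) :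
    |a| ^ p + p * |a| ^ (p - 2) * a * (b - a) ≤ |b| ^ p := by
  have hconv : ConvexOn ℝ Set.univ (fun x : ℝ => |x| ^ p) := by
    have h1 : ConvexOn ℝ (Set.univ : Set ℝ) (fun x : ℝ => |x|) := by
      exact (convexOn_univ_norm (E := ℝ))
    refine ⟨convex_univ, fun x _ y _ s t hs ht hst => ?_⟩
    have h2 := h1.2 (Set.mem_univ x) (Set.mem_univ y) hs ht hst
    have h3 := (convexOn_rpow hp.le).2 (abs_nonneg x) (abs_nonneg y) hs ht hst
    exact (Real.rpow_le_rpow (abs_nonneg _) h2 (by linarith)).trans h3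
  have hd := hasDerivAt_abs_rpow a hp
  rcases lt_trichotomy a b with h | h | h
  · have := hconv.le_slope_of_hasDerivAt (Set.mem_univ a) (Set.mem_univ b) h hd
    rw [slope_def_field, le_div_iff₀ (by linarith)] at this
    linarith
  · subst h; simp
  · have := hconv.slope_le_of_hasDerivAt (Set.mem_univ b) (Set.mem_univ a) h hd
    rw [slope_def_field, div_le_iff₀ (by linarith)] at this
    linarith

lemma one_dim {ρ : ℝ} (hρ : 0 < ρ) (A B G G' : ℝ → ℝ)
    (hA : ContinuousOn A (Set.Ioc 0 ρ)) (hB : ContinuousOn B (Set.Ioc 0 ρ))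
    (hG' : ContinuousOn G' (Set.Ioc 0 ρ))
    (hB0 : ∀ r ∈ Set.Ioc 0 ρ, 0 ≤ B r) (hA0 : ∀ r ∈ Set.Ioc 0 ρ, 0 ≤ A r)
    (hG : ∀ r ∈ Set.Ioc 0 ρ, HasDerivAt G (G' r) r)
    (hle : ∀ r ∈ Set.Ioc 0 ρ, A r ≤ B r + G' r)
    (hGρ : G ρ = 0) (hG0 : Filter.Tendsto G (nhdsWithin 0 (Set.Ioi 0)) (nhds 0)) :
    ∫⁻ r in Set.Ioc 0 ρ, ENNReal.ofReal (A r) ≤ ∫⁻ r in Set.Ioc 0 ρ, ENNReal.ofReal (B r) := by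
  have key : ∀ ε, 0 < ε → ε ≤ ρ → ∫⁻ r in Set.Ioc ε ρ, ENNReal.ofReal (A r) ≤
      (∫⁻ r in Set.Ioc 0 ρ, ENNReal.ofReal (B r)) + ENNReal.ofReal (- G ε) := by
    intro ε hε hερ
    have hsub : Set.Icc ε ρ ⊆ Set.Ioc 0 ρ := fun r hr => ⟨lt_of_lt_of_le hε hr.1, hr.2⟩
    have hsub' : Set.Ioc ε ρ ⊆ Set.Ioc 0 ρ := fun r hr => ⟨hε.trans hr.1, hr.2⟩
    have iA : IntervalIntegrable A volume ε ρ := 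
      (hA.mono hsub).intervalIntegrable_of_Icc hερ
    have iB : IntervalIntegrable B volume ε ρ := 
      (hB.mono hsub).intervalIntegrable_of_Icc hερ
    have iG : IntervalIntegrable G' volume ε ρ := 
      (hG'.mono hsub).intervalIntegrable_of_Icc hερ
    have h1 : ∫ r in ε..ρ, A r ≤ ∫ r in ε..ρ, (B r + G' r) :=
      intervalIntegral.integral_mono_on hερ iA (iB.add iG) (fun r hr => hle r (hsub hr))
    have h2 : ∫ r in ε..ρ, G' r = G ρ - G ε :=
      intervalIntegral.integral_eq_sub_of_hasDerivAt
        (fun r hr => hG r (hsub (by rwa [Set.uIcc_of_le hερ] at hr))) iG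
    rw [intervalIntegral.integral_add iB iG, h2, hGρ, zero_sub,
      intervalIntegral.integral_of_le hερ, intervalIntegral.integral_of_le hερ] at h1
    have eA := ofReal_integral_eq_lintegral_ofReal (iA.1)
      ((ae_restrict_iff' measurableSet_Ioc).2 (.of_forall fun r hr => hA0 r (hsub' hr)))
    have eB := ofReal_integral_eq_lintegral_ofReal (iB.1)
      ((ae_restrict_iff' measurableSet_Ioc).2 (.of_forall fun r hr => hB0 r (hsub' hr)))
    rw [← eA]
    calc _ ≤ _ := ENNReal.ofReal_le_ofReal h1
      _ ≤ _ := ENNReal.ofReal_add_le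
      _ ≤ _ := by
        rw [eB]
        gcongr
  have hs : Set.Ioc 0 ρ = ⋃ k : ℕ, Set.Ioc (ρ / (k + 1)) ρ := by
    ext r
    simp only [Set.mem_Ioc, Set.mem_iUnion]
    constructor
    · rintro ⟨h0, h1⟩
      obtain ⟨k, hk⟩ := exists_nat_gt (ρ / r)
      refine ⟨k, ?_, h1⟩
      rw [div_lt_iff₀ (by positivity)]
      rw [div_lt_iff₀ h0] at hk
      nlinarith
    · rintro ⟨k, h0, h1⟩
      exact ⟨lt_trans (by positivity) h0, h1⟩
  have hmono : Monotone (fun k : ℕ => Set.Ioc (ρ / ((k : ℝ) + 1)) ρ) := by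
    intro i j hij
    apply Set.Ioc_subset_Ioc_left
    have : (i : ℝ) ≤ j := by exact_mod_cast hij
    gcongr
  conv_lhs => rw [hs]
  rw [setLIntegral_iUnion_of_directed _ hmono.directed_le]
  have t1 := tendsto_atTop_iSup (f := fun k : ℕ => ∫⁻ r in Set.Ioc (ρ / ((k : ℝ) + 1)) ρ, ENNReal.ofReal (A r))
    (fun i j hij => lintegral_mono_set (hmono hij))
  have t0 : Filter.Tendsto (fun k : ℕ => ρ / ((k : ℝ) + 1)) Filter.atTop
      (nhdsWithin 0 (Set.Ioi 0)) := by
    refine tendsto_nhdsWithin_iff.2 ⟨?_, .of_forall fun k => ?_⟩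
    · simpa [div_eq_mul_inv] using (tendsto_one_div_add_atTop_nhds_zero_nat (𝕜 := ℝ)).const_mul ρ
    · exact Set.mem_Ioi.2 (by positivity)
  have t2 : Filter.Tendsto (fun k : ℕ => (∫⁻ r in Set.Ioc 0 ρ, ENNReal.ofReal (B r)) +
      ENNReal.ofReal (- G (ρ / ((k : ℝ) + 1)))) Filter.atTop
      (nhds ((∫⁻ r in Set.Ioc 0 ρ, ENNReal.ofReal (B r)))) := by
    have := ENNReal.tendsto_ofReal (hG0.comp t0).neg
    simpa using this.const_add (∫⁻ r in Set.Ioc 0 ρ, ENNReal.ofReal (B r))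
  refine le_of_tendsto_of_tendsto' t1 t2 fun k => key _ (by positivity) ?_
  exact div_le_self hρ.le (by linarith [(Nat.cast_nonneg k : (0:ℝ) ≤ k)])

lemma lintegral_polar {n : ℕ} (hn : 3 ≤ n) (g : EuclideanSpace ℝ (Fin n) → ENNReal)
    (hg : Measurable g) :
    ∫⁻ x, g x = ∫⁻ ω : Metric.sphere (0 : EuclideanSpace ℝ (Fin n)) 1,
      (∫⁻ r in Set.Ioi (0 : ℝ), ENNReal.ofReal (r ^ (n - 1)) * g (r • (ω : EuclideanSpace ℝ (Fin n))))
        ∂(volume : Measure (EuclideanSpace ℝ (Fin n))).toSphere := by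
  let E := EuclideanSpace ℝ (Fin n)
  have : Nontrivial E := by
    have : Nonempty (Fin n) := ⟨⟨0, by omega⟩⟩
    infer_instance
  have hdim : Module.finrank ℝ E = n := by simp [E]
  have hm : Measurable (fun q : Metric.sphere (0 : E) 1 × Set.Ioi (0 : ℝ) => g ((q.2 : ℝ) • (q.1 : E))) := by
    apply hg.comp
    fun_prop
  calc ∫⁻ x, g x = ∫⁻ x : ({(0 : E)}ᶜ : Set E), g x ∂((volume : Measure E).comap Subtype.val) := by
        rw [lintegral_subtype_comap (measurableSet_singleton _).compl, restrict_compl_singleton]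
    _ = ∫⁻ q, g ((q.2 : ℝ) • (q.1 : E))
        ∂(volume : Measure E).toSphere.prod (.volumeIoiPow (Module.finrank ℝ E - 1)) := by
      rw [← (volume : Measure E).measurePreserving_homeomorphUnitSphereProd.lintegral_comp hm]
      refine lintegral_congr fun x => ?_
      have hx : ‖(x : E)‖ ≠ 0 := norm_ne_zero_iff.2 x.2
      simp [smul_smul, hx]
    _ = _ := by
      rw [lintegral_prod _ hm.aemeasurable]
      refine lintegral_congr fun ω => ?_
      have hmω : Measurable (fun r : ℝ => g (r • (ω : E))) := by
        apply hg.comp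
        fun_prop
      have h3 := lintegral_withDensity_eq_lintegral_mul
        (Measure.comap Subtype.val volume : Measure (Set.Ioi (0 : ℝ)))
        (f := fun r => ENNReal.ofReal ((r : ℝ) ^ (Module.finrank ℝ E - 1))) (by fun_prop)
        (hmω.comp measurable_subtype_coe)
      refine h3.trans ?_
      rw [hdim]
      exact lintegral_subtype_comap measurableSet_Ioi
        (fun r : ℝ => ENNReal.ofReal (r ^ (n - 1)) * g (r • (ω : E)))

lemma ndim {n : ℕ} (hn : 3 ≤ n) {ρ : ℝ} (a b : EuclideanSpace ℝ (Fin n) → ℝ)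
    (ha : Measurable a) (hb : Measurable b) (ha0 : ∀ x, ρ < ‖x‖ → a x = 0)
    (h : ∀ ω : EuclideanSpace ℝ (Fin n), ‖ω‖ = 1 →
      ∫⁻ r in Set.Ioc 0 ρ, ENNReal.ofReal (a (r • ω) / r) ≤
        ∫⁻ r in Set.Ioc 0 ρ, ENNReal.ofReal (b (r • ω) / r)) :
    ∫⁻ x, ENNReal.ofReal (a x / ‖x‖ ^ (n : ℝ)) ≤ ∫⁻ x, ENNReal.ofReal (b x / ‖x‖ ^ (n : ℝ)) := by
  have aux : ∀ (c : EuclideanSpace ℝ (Fin n) → ℝ) (ω : EuclideanSpace ℝ (Fin n)), ‖ω‖ = 1 →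
      ∫⁻ r in Set.Ioi (0 : ℝ), ENNReal.ofReal (r ^ (n - 1)) *
        ENNReal.ofReal (c (r • ω) / ‖r • ω‖ ^ (n : ℝ)) =
      ∫⁻ r in Set.Ioi (0 : ℝ), ENNReal.ofReal (c (r • ω) / r) := by
    intro c ω hω
    refine setLIntegral_congr_fun measurableSet_Ioi fun r hr => ?_
    have hr : 0 < r := hr
    rw [← ENNReal.ofReal_mul (by positivity), norm_smul, hω, mul_one, Real.norm_of_nonneg hr.le,
      Real.rpow_natCast]
    congr 1
    obtain ⟨m, rfl⟩ : ∃ m, n = m + 1 := ⟨n - 1, by omega⟩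
    simp only [Nat.add_sub_cancel]
    field_simp
    ring
  rw [lintegral_polar hn _ (by fun_prop), lintegral_polar hn _ (by fun_prop)]
  refine lintegral_mono fun ω => ?_
  have hω : ‖(ω : EuclideanSpace ℝ (Fin n))‖ = 1 := by simp
  rw [aux a _ hω, aux b _ hω]
  calc _ = ∫⁻ r in Set.Ioc 0 ρ, ENNReal.ofReal (a (r • (ω : EuclideanSpace ℝ (Fin n))) / r) := by
        rw [← lintegral_indicator measurableSet_Ioi, ← lintegral_indicator measurableSet_Ioc]
        refine lintegral_congr fun r => ?_
        by_cases h1 : r ∈ Set.Ioc 0 ρ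
        · rw [Set.indicator_of_mem h1, Set.indicator_of_mem (show r ∈ Set.Ioi 0 from h1.1)]
        rw [Set.indicator_of_notMem h1]
        by_cases h2 : r ∈ Set.Ioi 0
        swap
        · rw [Set.indicator_of_notMem h2]
        rw [Set.indicator_of_mem h2]
        have hr0 : 0 < r := h2
        have : ρ < r := by
          by_contra hc
          exact h1 ⟨hr0, not_lt.1 hc⟩
        rw [ha0, zero_div, ENNReal.ofReal_zero]
        rwa [norm_smul, hω, mul_one, Real.norm_of_nonneg hr0.le]
    _ ≤ _ := h _ hω
    _ ≤ _ := lintegral_mono_set (fun r hr => hr.1)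

/-- Euler operator plus constant. -/
noncomputable def eulOp {n : ℕ} (c : ℝ) (F : EuclideanSpace ℝ (Fin n) → ℝ)
    (x : EuclideanSpace ℝ (Fin n)) : ℝ := fderiv ℝ F x x + c * F x

/-- Smooth functions vanishing outside a ball. -/
def NiceFun {n : ℕ} (ρ : ℝ) (F : EuclideanSpace ℝ (Fin n) → ℝ) : Prop :=
  ContDiff ℝ (⊤ : ℕ∞) F ∧ ∀ x, ρ < ‖x‖ → F x = 0

lemma NiceFun.eulOp {n : ℕ} {ρ : ℝ} {F : EuclideanSpace ℝ (Fin n) → ℝ} (h : NiceFun ρ F) (c : ℝ) :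
    NiceFun ρ (eulOp c F) := by
  refine ⟨?_, fun x hx => ?_⟩
  · have h1 : ContDiff ℝ (⊤ : ℕ∞) (fderiv ℝ F) := h.1.fderiv_right (by simp)
    exact (h1.clm_apply contDiff_id).add (contDiff_const.mul h.1)
  · have : F =ᶠ[nhds x] fun _ => 0 := by
      filter_upwards [(isOpen_lt continuous_const continuous_norm).mem_nhds hx] with y hy
      exact h.2 y hy
    simp [_root_.eulOp, this.fderiv_eq, h.2 x hx]

lemma eulOp_zero {n : ℕ} (c : ℝ) (F : EuclideanSpace ℝ (Fin n) → ℝ) : eulOp c F 0 = c * F 0 := by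
  simp [eulOp]

/-- The weighted `L^p` quantity. -/
noncomputable def JJ {n : ℕ} (p : ℝ) (F : EuclideanSpace ℝ (Fin n) → ℝ) : ENNReal :=
  ∫⁻ x, ENNReal.ofReal (|F x| ^ p / ‖x‖ ^ (n : ℝ))

lemma JJ_const_mul {n : ℕ} {p : ℝ} (c : ℝ) (F : EuclideanSpace ℝ (Fin n) → ℝ) :
    JJ p (fun x => c * F x) = ENNReal.ofReal (|c| ^ p) * JJ p F := by
  unfold JJ
  rw [← lintegral_const_mul' _ _ ENNReal.ofReal_ne_top]
  refine lintegral_congr fun x => ?_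
  rw [← ENNReal.ofReal_mul (by positivity), abs_mul, Real.mul_rpow (abs_nonneg _) (abs_nonneg _),
    mul_div_assoc]

lemma hasDerivAt_ray {n : ℕ} {F : EuclideanSpace ℝ (Fin n) → ℝ} (h : ContDiff ℝ (⊤ : ℕ∞) F)
    (ω : EuclideanSpace ℝ (Fin n)) (r : ℝ) :
    HasDerivAt (fun r : ℝ => F (r • ω)) (fderiv ℝ F (r • ω) ω) r := by
  have h1 : HasFDerivAt F (fderiv ℝ F (r • ω)) (r • ω) :=
    (h.differentiable (by simp) _).hasFDerivAt
  have h2 : HasDerivAt (fun r : ℝ => r • ω) ω r := by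
    simpa using (hasDerivAt_id r).smul_const ω
  exact h1.comp_hasDerivAt r h2

lemma continuous_ray {n : ℕ} {F : EuclideanSpace ℝ (Fin n) → ℝ} (h : ContDiff ℝ (⊤ : ℕ∞) F)
    (ω : EuclideanSpace ℝ (Fin n)) :
    Continuous (fun r : ℝ => fderiv ℝ F (r • ω) ω) := by
  have h1 : Continuous (fderiv ℝ F) := h.continuous_fderiv (by simp)
  fun_prop

lemma continuous_abs_rpow_deriv {p : ℝ} (hp : 1 < p) :
    Continuous (fun x : ℝ => p * |x| ^ (p - 2) * x) := by
  have h := (contDiff_norm_rpow (E := ℝ) hp).continuous_deriv (le_refl _)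
  convert h using 1
  ext x
  exact (hasDerivAt_abs_rpow x hp).deriv.symm

lemma continuous_abs_rpow {p : ℝ} (hp : 1 < p) : Continuous (fun x : ℝ => |x| ^ p) :=
  continuous_abs.rpow_const fun _ => Or.inr (by linarith)

lemma JJ_eulOp {n : ℕ} (hn : 3 ≤ n) {p : ℝ} (hp : 1 < p) {ρ : ℝ} (hρ : 0 < ρ)
    {F : EuclideanSpace ℝ (Fin n) → ℝ} (hF : NiceFun ρ F) (hF0 : F 0 = 0) (c : ℝ) :
    ENNReal.ofReal (|c| ^ p) * JJ p F ≤ JJ p (eulOp c F) := by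
  rcases eq_or_ne c 0 with rfl | hc
  · simp [Real.zero_rpow (show p ≠ 0 by linarith)]
  rw [← JJ_const_mul]
  have hFc : Continuous F := hF.1.continuous
  have hEc : Continuous (eulOp c F) := (hF.eulOp c).1.continuous
  have hpc := continuous_abs_rpow hp
  refine ndim hn (ρ := ρ + 1) _ _ ?_ ?_ ?_ ?_
  · exact (hpc.comp (continuous_const.mul hFc)).measurable
  · exact (hpc.comp hEc).measurable
  · intro x hx
    simp only [hF.2 x (by linarith)]
    rw [mul_zero, abs_zero, Real.zero_rpow (by linarith)]
  intro ω hω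
  have hsc : Continuous (fun r : ℝ => r • ω) := by fun_prop
  have hd := hasDerivAt_ray hF.1 ω
  have hdc := continuous_ray hF.1 ω
  have hrc : ContinuousOn (fun r : ℝ => r) (Set.Ioc 0 (ρ + 1)) := continuousOn_id
  have hr0 : ∀ r ∈ Set.Ioc 0 (ρ + 1), r ≠ 0 := fun r hr => hr.1.ne'
  have hp0 : p ≠ 0 := by linarith
  have hGc : Continuous (fun r : ℝ => - (|c * F (r • ω)| ^ p / c)) :=
    ((hpc.comp (continuous_const.mul (hFc.comp hsc))).div_const c).neg
  refine one_dim (by linarith) _ _ (fun r => - (|c * F (r • ω)| ^ p / c))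
    (fun r => - ((p * |c * F (r • ω)| ^ (p - 2) * (c * F (r • ω))) * fderiv ℝ F (r • ω) ω))
    ?_ ?_ ?_ ?_ ?_ ?_ ?_ ?_ ?_
  · exact (hpc.comp (continuous_const.mul (hFc.comp hsc))).continuousOn.div hrc hr0
  · exact (hpc.comp (hEc.comp hsc)).continuousOn.div hrc hr0
  · exact (((continuous_abs_rpow_deriv hp).comp
      (continuous_const.mul (hFc.comp hsc))).mul hdc).neg.continuousOn
  · intro r hr
    have := hr.1
    positivity
  · intro r hr
    have := hr.1
    positivity
  · intro r hr
    have h1 := (((hasDerivAt_abs_rpow (c * F (r • ω)) hp).comp r ((hd r).const_mul c)).div_const c).neg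
    have e : ∀ a b : ℝ, a * b = a * (c * b) / c := fun a b => by field_simp
    rw [e]
    exact h1
  · intro r hr
    have hr := hr.1
    have h1 := abs_rpow_tangent hp (c * F (r • ω)) (r * fderiv ℝ F (r • ω) ω + c * F (r • ω))
    simp only [eulOp, map_smul, smul_eq_mul]
    rw [div_le_iff₀ hr, add_mul, div_mul_cancel₀ _ hr.ne']
    linarith
  · have : F ((ρ + 1) • ω) = 0 := by
      apply hF.2
      rw [norm_smul, hω, mul_one, Real.norm_of_nonneg (by linarith)]
      linarith
    simp [this, Real.zero_rpow hp0]
  · have := (hGc.tendsto 0).mono_left (nhdsWithin_le_nhds (s := Set.Ioi 0))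
    simpa [hF0, Real.zero_rpow hp0] using this

lemma abs_rpow_split {p : ℝ} (hp : 1 < p) (a : ℝ) : |a| ^ (p - 2) * a * a = |a| ^ p := by
  rcases eq_or_ne a 0 with rfl | ha
  · simp [Real.zero_rpow (show p ≠ 0 by linarith)]
  · rw [mul_assoc, ← abs_mul_abs_self a, ← sq, ← Real.rpow_natCast |a| 2,
      ← Real.rpow_add (abs_pos.2 ha)]
    norm_num

lemma hardy_crit {n : ℕ} (hn : 3 ≤ n) {p : ℝ} (hp : 1 < p) {ρ : ℝ} (hρ : 0 < ρ) (hρ1 : ρ < 1)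
    {F : EuclideanSpace ℝ (Fin n) → ℝ} (hF : NiceFun ρ F) :
    ∫⁻ x, ENNReal.ofReal (|F x| ^ p / (‖x‖ ^ (n : ℝ) * Real.log (1 / ‖x‖) ^ p)) ≤
      ENNReal.ofReal (|p / (p - 1)| ^ p) * JJ p (eulOp 0 F) := by
  rw [← JJ_const_mul]
  have hFc : Continuous F := hF.1.continuous
  have hEc : Continuous (eulOp 0 F) := (hF.eulOp 0).1.continuous
  have hpc := continuous_abs_rpow hp
  have hp0 : p ≠ 0 := by linarith
  have hcomm : ∀ x : EuclideanSpace ℝ (Fin n),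
      |F x| ^ p / (‖x‖ ^ (n : ℝ) * Real.log (1 / ‖x‖) ^ p) =
      (|F x| ^ p / Real.log (1 / ‖x‖) ^ p) / ‖x‖ ^ (n : ℝ) := by
    intro x
    rw [div_div, mul_comm]
  simp_rw [hcomm]
  set σ := (ρ + 1) / 2 with hσ
  have hσ0 : 0 < σ := by linarith
  have hσ1 : σ < 1 := by linarith
  have hσρ : ρ < σ := by linarith
  refine ndim hn (ρ := σ) _ _ ?_ ?_ ?_ ?_
  · exact (hpc.comp hFc).measurable.div (by fun_prop)
  · exact (hpc.comp (continuous_const.mul hEc)).measurable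
  · intro x hx
    rw [hF.2 x (by linarith), abs_zero, Real.zero_rpow (by linarith), zero_div]
  intro ω hω
  have hsc : Continuous (fun r : ℝ => r • ω) := by fun_prop
  have hd := hasDerivAt_ray hF.1 ω
  have hdc := continuous_ray hF.1 ω
  have hrc : ContinuousOn (fun r : ℝ => r) (Set.Ioc 0 σ) := continuousOn_id
  have hr0 : ∀ r ∈ Set.Ioc 0 σ, r ≠ 0 := fun r hr => hr.1.ne'
  have hL : ∀ r ∈ Set.Ioc 0 σ, 0 < - Real.log r := fun r hr =>
    neg_pos.2 (Real.log_neg hr.1 (by linarith [hr.2]))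
  have hLc : ContinuousOn (fun r => - Real.log r) (Set.Ioc 0 σ) :=
    (Real.continuousOn_log.mono fun r hr => hr0 r hr).neg
  have hLpc : ∀ s : ℝ, ContinuousOn (fun r => (- Real.log r) ^ s) (Set.Ioc 0 σ) := fun s =>
    hLc.rpow_const fun r hr => Or.inl (hL r hr).ne'
  have hA : ∫⁻ r in Set.Ioc 0 σ, ENNReal.ofReal (|F (r • ω)| ^ p / Real.log (1 / ‖r • ω‖) ^ p / r) =
      ∫⁻ r in Set.Ioc 0 σ, ENNReal.ofReal (|F (r • ω)| ^ p / (- Real.log r) ^ p / r) := by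
    refine setLIntegral_congr_fun measurableSet_Ioc fun r hr => ?_
    rw [norm_smul, hω, mul_one, Real.norm_of_nonneg hr.1.le, one_div, Real.log_inv]
  rw [hA]
  refine one_dim hσ0 _ _
    (fun r => p / (p - 1) * (|F (r • ω)| ^ p * (- Real.log r) ^ (1 - p)))
    (fun r => p / (p - 1) * (p * |F (r • ω)| ^ (p - 2) * F (r • ω) * fderiv ℝ F (r • ω) ω *
      (- Real.log r) ^ (1 - p) +
      |F (r • ω)| ^ p * (- r⁻¹ * (1 - p) * (- Real.log r) ^ (1 - p - 1))))
    ?_ ?_ ?_ ?_ ?_ ?_ ?_ ?_ ?_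
  · refine ((hpc.comp (hFc.comp hsc)).continuousOn.div (hLpc p) ?_).div hrc hr0
    exact fun r hr => (Real.rpow_pos_of_pos (hL r hr) p).ne'
  · exact (hpc.comp (continuous_const.mul (hEc.comp hsc))).continuousOn.div hrc hr0
  · refine continuousOn_const.mul (ContinuousOn.add ?_ ?_)
    · exact ((((continuous_abs_rpow_deriv hp).comp (hFc.comp hsc)).mul hdc).continuousOn).mul (hLpc _)
    · exact (hpc.comp (hFc.comp hsc)).continuousOn.mul
        (((hrc.inv₀ hr0).neg.mul continuousOn_const).mul (hLpc _))
  · intro r hr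
    have := hr.1
    positivity
  · intro r hr
    have := hr.1
    have := hL r hr
    positivity
  · intro r hr
    have h1 := (hasDerivAt_abs_rpow (F (r • ω)) hp).comp r (hd r)
    have h2 := ((Real.hasDerivAt_log (hr0 r hr)).neg).rpow_const (p := 1 - p) (Or.inl (hL r hr).ne')
    exact (h1.mul h2).const_mul _
  · intro r hr
    have hLr := hL r hr
    have hr := hr.1
    set L := - Real.log r with hLdef
    set u := F (r • ω) with hu
    set v := fderiv ℝ F (r • ω) ω with hv
    have h1 := abs_rpow_tangent hp (u / L) (- (p / (p - 1) * (r * v)))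
    have hs := abs_rpow_split hp u
    simp only [eulOp, map_smul, smul_eq_mul, zero_mul, add_zero]
    rw [abs_neg, abs_div, abs_of_pos hLr, Real.div_rpow (abs_nonneg _) hLr.le,
      Real.div_rpow (abs_nonneg _) hLr.le] at h1
    set M := L ^ (p - 1) with hM
    have hMpos : 0 < M := Real.rpow_pos_of_pos hLr _
    have e1 : L ^ p = M * L := by
      rw [hM, ← Real.rpow_add_one hLr.ne']; congr 1; ring
    have e2 : L ^ (p - 2) = M / L := by
      rw [hM, ← Real.rpow_sub_one hLr.ne']; congr 1; ring
    have e3 : L ^ (1 - p) = 1 / M := by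
      rw [hM, one_div, ← Real.rpow_neg hLr.le]; congr 1; ring
    have e4 : L ^ (1 - p - 1) = 1 / (M * L) := by
      rw [← e1, one_div, ← Real.rpow_neg hLr.le]; congr 1; ring
    rw [e1, e2] at h1
    rw [e1, e3, e4]
    have hp1 : 0 < p - 1 := by linarith
    rw [div_le_iff₀ hr, add_mul, div_mul_cancel₀ _ hr.ne']
    refine le_trans (le_of_eq ?_) (add_le_add_left h1 _)
    generalize |u| ^ (p - 2) = w at *
    rw [← hs]
    field_simp
    ring
  · have : F (σ • ω) = 0 := by
      apply hF.2
      rw [norm_smul, hω, mul_one, Real.norm_of_nonneg (by linarith)]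
      linarith
    simp [this, Real.zero_rpow hp0]
  · have t1 : Filter.Tendsto (fun r : ℝ => |F (r • ω)| ^ p) (nhdsWithin 0 (Set.Ioi 0))
        (nhds (|F ((0 : ℝ) • ω)| ^ p)) :=
      ((hpc.comp (hFc.comp hsc)).tendsto 0).mono_left nhdsWithin_le_nhds
    have t2 : Filter.Tendsto (fun r : ℝ => (- Real.log r) ^ (1 - p)) (nhdsWithin 0 (Set.Ioi 0))
        (nhds 0) := by
      have := (tendsto_rpow_neg_atTop (show 0 < p - 1 by linarith)).comp
        (Filter.tendsto_neg_atBot_atTop.comp Real.tendsto_log_nhdsGT_zero)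
      simpa [Function.comp_def] using this
    simpa using (t1.mul t2).const_mul (p / (p - 1))

lemma JJ_lt_top {n : ℕ} (hn : 3 ≤ n) {p : ℝ} (hp : 1 < p) {ρ : ℝ} (hρ1 : ρ < 1)
    {F : EuclideanSpace ℝ (Fin n) → ℝ} (hF : NiceFun ρ F) (hF0 : F 0 = 0) :
    JJ p F ≠ ⊤ := by
  have : Nontrivial (EuclideanSpace ℝ (Fin n)) := by
    have : Nonempty (Fin n) := ⟨⟨0, by omega⟩⟩
    infer_instance
  have hcs : HasCompactSupport F := by
    refine HasCompactSupport.intro (isCompact_closedBall (0 : EuclideanSpace ℝ (Fin n)) ρ) fun x hx => ?_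
    apply hF.2
    simpa using hx
  obtain ⟨C, hC⟩ := ContDiff.lipschitzWith_of_hasCompactSupport hcs hF.1 (by simp)
  have hb : ∀ x, |F x| ≤ C * ‖x‖ := fun x => by
    simpa [hF0] using hC.dist_le_mul x 0
  have hint : IntegrableOn (fun x : EuclideanSpace ℝ (Fin n) => (C : ℝ) ^ p * ‖x‖ ^ (p - n))
      (Metric.ball 0 1) := by
    refine Integrable.const_mul ?_ _
    have := (integrableOn_fun_norm_addHaar (volume : Measure (EuclideanSpace ℝ (Fin n)))
      (f := fun y : ℝ => y ^ (p - n)) (r := 1)).2 ?_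
    · exact this
    have h1 : IntegrableOn (fun y : ℝ => y ^ (p - 1)) (Set.Ioo 0 1) :=
      (intervalIntegral.integrableOn_Ioo_rpow_iff one_pos).2 (by linarith)
    refine h1.congr_fun (fun y hy => ?_) measurableSet_Ioo
    have hy := hy.1
    simp only [finrank_euclideanSpace, Fintype.card_fin, smul_eq_mul]
    rw [← Real.rpow_natCast, ← Real.rpow_add hy, Nat.cast_sub (by omega)]
    congr 1
    push_cast
    ring
  have hle : JJ p F ≤ ∫⁻ x in Metric.ball (0 : EuclideanSpace ℝ (Fin n)) 1,
      ENNReal.ofReal ((C : ℝ) ^ p * ‖x‖ ^ (p - n)) := by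
    unfold JJ
    rw [← lintegral_indicator measurableSet_ball]
    refine lintegral_mono fun x => ?_
    by_cases hx : x ∈ Metric.ball (0 : EuclideanSpace ℝ (Fin n)) 1
    · rw [Set.indicator_of_mem hx]
      rcases eq_or_ne x 0 with rfl | hx0
      · simp [hF0, Real.zero_rpow (show p ≠ 0 by linarith)]
      have hxp : 0 < ‖x‖ := norm_pos_iff.2 hx0
      apply ENNReal.ofReal_le_ofReal
      rw [Real.rpow_sub hxp, ← mul_div_assoc, ← Real.mul_rpow (NNReal.coe_nonneg C) hxp.le]
      gcongr
      exact hb x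
    · rw [hF.2 x, abs_zero, Real.zero_rpow (by linarith), zero_div, ENNReal.ofReal_zero]
      · exact zero_le
      · have : 1 ≤ ‖x‖ := by simpa using hx
        linarith
  exact ne_top_of_le_ne_top hint.lintegral_lt_top.ne hle

lemma radDeriv_eq {n : ℕ} (m : ℤ) (u H : EuclideanSpace ℝ (Fin n) → ℝ)
    (hH : ContDiff ℝ (⊤ : ℕ∞) H) (hu : ∀ x, x ≠ 0 → u x = ‖x‖ ^ m * H x) :
    ∀ x, x ≠ 0 → radDeriv u x = ‖x‖ ^ (m - 1) * eulOp m H x := by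
  intro x hx
  have hxp : 0 < ‖x‖ := norm_pos_iff.2 hx
  have hev : u =ᶠ[nhds x] fun y => ‖y‖ ^ m * H y := by
    filter_upwards [isOpen_ne.mem_nhds hx] with y hy
    exact hu y hy
  unfold radDeriv
  rw [hev.fderiv_eq, map_smul, smul_eq_mul]
  have hHd : DifferentiableAt ℝ H x := hH.differentiable (by simp) x
  have hn : DifferentiableAt ℝ (fun y : EuclideanSpace ℝ (Fin n) => ‖y‖ ^ m * H y) x :=
    ((differentiableAt_id.norm ℝ hx).zpow (Or.inl hxp.ne')).mul hHd
  have h2 : HasDerivAt (fun t : ℝ => t • x) x 1 := by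
    simpa using (hasDerivAt_id (1 : ℝ)).smul_const x
  have h3 : HasDerivAt (fun t : ℝ => ‖t • x‖ ^ m * H (t • x))
      (fderiv ℝ (fun y : EuclideanSpace ℝ (Fin n) => ‖y‖ ^ m * H y) x x) 1 := by
    have := hn.hasFDerivAt
    rw [← one_smul ℝ x] at this
    have := this.comp_hasDerivAt (1 : ℝ) h2
    simp only [one_smul] at this
    exact this
  have h4 : HasDerivAt (fun t : ℝ => (t ^ m * ‖x‖ ^ m) * H (t • x))
      (m * ‖x‖ ^ m * H x + ‖x‖ ^ m * fderiv ℝ H x x) 1 := by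
    have a1 := (hasDerivAt_zpow m (1 : ℝ) (Or.inl one_ne_zero)).mul_const (‖x‖ ^ m)
    have a2 := a1.mul (hasDerivAt_ray hH x 1)
    simp only [one_zpow, one_smul, one_mul, mul_one] at a2
    exact a2
  have h5 : (fun t : ℝ => ‖t • x‖ ^ m * H (t • x)) =ᶠ[nhds 1]
      (fun t : ℝ => (t ^ m * ‖x‖ ^ m) * H (t • x)) := by
    filter_upwards [isOpen_Ioi.mem_nhds (show (1 : ℝ) ∈ Set.Ioi 0 from Set.mem_Ioi.2 one_pos)] with t ht
    rw [norm_smul, Real.norm_of_nonneg (le_of_lt ht), mul_zpow]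
  rw [h3.unique (h4.congr_of_eventuallyEq h5), zpow_sub_one₀ hxp.ne', eulOp]
  ring

/-- Numerators of the iterated radial Laplacians. -/
noncomputable def numSeq {n : ℕ} (f : EuclideanSpace ℝ (Fin n) → ℝ) :
    ℕ → EuclideanSpace ℝ (Fin n) → ℝ
  | 0 => f
  | k + 1 => eulOp ((n : ℝ) - 2 * k - 2) (eulOp (-(2 * (k : ℝ))) (numSeq f k))

lemma numSeq_nice {n : ℕ} {ρ : ℝ} {f : EuclideanSpace ℝ (Fin n) → ℝ} (hf : NiceFun ρ f) (k : ℕ) :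
    NiceFun ρ (numSeq f k) := by
  induction k with
  | zero => exact hf
  | succ k ih => exact (ih.eulOp _).eulOp _

lemma numSeq_zero {n : ℕ} (f : EuclideanSpace ℝ (Fin n) → ℝ) (k : ℕ) : numSeq f (k + 1) 0 = 0 := by
  induction k with
  | zero => simp [numSeq, eulOp_zero]
  | succ k ih => rw [numSeq, eulOp_zero, eulOp_zero, ih]; simp

lemma radLap_iter {n : ℕ} {ρ : ℝ} {f : EuclideanSpace ℝ (Fin n) → ℝ} (hf : NiceFun ρ f) (k : ℕ) :
    ∀ x, x ≠ 0 → (radLap^[k] f) x = ‖x‖ ^ (-(2 * (k : ℤ))) * numSeq f k x := by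
  induction k with
  | zero => intro x _; simp [numSeq]
  | succ k ih =>
    have hN := numSeq_nice hf k
    have h1 := radDeriv_eq _ _ _ hN.1 ih
    have h2 := radDeriv_eq _ _ _ (hN.eulOp _).1 h1
    intro x hx
    have hxp : 0 < ‖x‖ := norm_pos_iff.2 hx
    rw [Function.iterate_succ_apply', radLap, h2 x hx, h1 x hx, numSeq]
    have e : (-(2 * ((k + 1 : ℕ) : ℤ))) = -(2 * (k : ℤ)) - 1 - 1 := by push_cast; ring
    rw [e, zpow_sub_one₀ hxp.ne']
    simp only [eulOp]
    push_cast
    field_simp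
    ring

lemma ennreal_div {X Y : ENNReal} {c p : ℝ} (hc : 0 < c)
    (h : ENNReal.ofReal (|c| ^ p) * X ≤ Y) : X ≤ ENNReal.ofReal (c⁻¹ ^ p) * Y := by
  calc X = ENNReal.ofReal (c⁻¹ ^ p) * (ENNReal.ofReal (|c| ^ p) * X) := by
        rw [← mul_assoc, ← ENNReal.ofReal_mul (by positivity), abs_of_pos hc,
          ← Real.mul_rpow (by positivity) hc.le, inv_mul_cancel₀ hc.ne', Real.one_rpow]
        simp
    _ ≤ _ := by gcongr

lemma chain {n : ℕ} (hn : 3 ≤ n) {p : ℝ} (hp : 1 < p) {ρ : ℝ} (hρ : 0 < ρ)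
    {f : EuclideanSpace ℝ (Fin n) → ℝ} (hf : NiceFun ρ f) (l : ℕ) (hl : 2 * (l + 1) < n) :
    JJ p (eulOp 0 f) ≤ ENNReal.ofReal ((((2 : ℝ) ^ (1 - ((l + 1 : ℕ) : ℝ)) / (l + 1 - 1).factorial) *
      ∏ i ∈ Finset.range (l + 1), 1 / ((n : ℝ) - 2 * i - 2)) ^ p) * JJ p (numSeq f (l + 1)) := by
  have hpos : ∀ i : ℕ, 2 * (i + 1) < n → 0 < (n : ℝ) - 2 * i - 2 := by
    intro i hi
    have : ((2 * (i + 1) : ℕ) : ℝ) < n := by exact_mod_cast hi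
    push_cast at this
    linarith
  have hprod : ∀ m : ℕ, 2 * m < n → 0 ≤ ∏ i ∈ Finset.range m, 1 / ((n : ℝ) - 2 * i - 2) := by
    intro m hm
    refine Finset.prod_nonneg fun i hi => ?_
    have := hpos i (by have := Finset.mem_range.1 hi; omega)
    positivity
  induction l with
  | zero =>
    have h := ennreal_div (hpos 0 hl) (JJ_eulOp hn hp hρ (hf.eulOp 0) (by simp [eulOp_zero]) _)
    simpa [numSeq] using h
  | succ l ih =>
    have ih := ih (by omega)
    have hN := numSeq_nice hf (l + 1)
    have hk : (0 : ℝ) < 2 * ((l + 1 : ℕ) : ℝ) := by positivity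
    have h1 := JJ_eulOp hn hp hρ hN (numSeq_zero f l) (-(2 * ((l + 1 : ℕ) : ℝ)))
    rw [abs_neg] at h1
    have h1 := ennreal_div hk h1
    have hq := hpos (l + 1) hl
    have h2 := ennreal_div hq (JJ_eulOp hn hp hρ (hN.eulOp (-(2 * ((l + 1 : ℕ) : ℝ))))
      (by rw [eulOp_zero, numSeq_zero, mul_zero]) _)
    have hP := hprod (l + 1) (by omega)
    refine ih.trans ((mul_le_mul_right (h1.trans (mul_le_mul_right h2 _)) _).trans (le_of_eq ?_))
    rw [← mul_assoc, ← mul_assoc, ← ENNReal.ofReal_mul (by positivity),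
      ← ENNReal.ofReal_mul (by positivity), ← Real.mul_rpow (by positivity) (by positivity),
      ← Real.mul_rpow (by positivity) (by positivity)]
    congr 3
    rw [Finset.prod_range_succ _ (l + 1)]
    have e : (2 : ℝ) ^ (1 - ((l + 1 + 1 : ℕ) : ℝ)) = 2 ^ (1 - ((l + 1 : ℕ) : ℝ)) / 2 := by
      rw [← Real.rpow_sub_one (by norm_num)]
      congr 1
      push_cast
      ring
    rw [e]
    simp only [Nat.add_sub_cancel, Nat.factorial_succ]
    push_cast at hq ⊢
    field_simp

/-- Euclidean case of the critical higher-order Rellich inequality, Theorem 4.6 (i). -/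
theorem critical_rellich_radial_higher_even (n l : ℕ) (hn : 3 ≤ n) (hl : 1 ≤ l) (p : ℝ)
    (hp1 : 1 < p) (hpn : p < n / (2 * l))
    (f : EuclideanSpace ℝ (Fin n) → ℝ) (hf : ContDiff ℝ (⊤ : ℕ∞) f) (hfc : HasCompactSupport f)
    (hsupp : tsupport f ⊆ Metric.ball (0 : EuclideanSpace ℝ (Fin n)) 1) :
    ∫ x in Metric.ball (0 : EuclideanSpace ℝ (Fin n)) 1,
        |f x| ^ p / (‖x‖ ^ (n : ℝ) * Real.log (1 / ‖x‖) ^ p) ≤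
      (p / (p - 1) * ((2 : ℝ) ^ (1 - (l : ℝ)) / (l - 1).factorial) *
          ∏ i ∈ Finset.range l, 1 / ((n : ℝ) - 2 * i - 2)) ^ p *
        ∫ x in Metric.ball (0 : EuclideanSpace ℝ (Fin n)) 1,
          |(radLap^[l] f) x| ^ p / ‖x‖ ^ ((n : ℝ) - 2 * l * p) := by
  obtain ⟨ρ, ⟨hρ, hρ1⟩, hsub⟩ := exists_pos_lt_subset_ball one_pos (isClosed_tsupport f) hsupp
  have hnice : NiceFun ρ f := by
    refine ⟨hf, fun x hx => ?_⟩
    by_contra hc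
    have := hsub (subset_tsupport f hc)
    rw [mem_ball_zero_iff] at this
    linarith
  have hp0 : p ≠ 0 := by linarith
  have hl' : (1 : ℝ) ≤ l := by exact_mod_cast hl
  have hln : 2 * l < n := by
    rw [lt_div_iff₀ (by positivity)] at hpn
    have : ((2 * l : ℕ) : ℝ) < n := by push_cast; nlinarith
    exact_mod_cast this
  obtain ⟨k, rfl⟩ : ∃ k, l = k + 1 := ⟨l - 1, by omega⟩
  have hN := numSeq_nice hnice (k + 1)
  have hfin := JJ_lt_top hn hp1 hρ1 hN (numSeq_zero f k)
  set D : ℝ := ((2 : ℝ) ^ (1 - ((k + 1 : ℕ) : ℝ)) / (k + 1 - 1).factorial) *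
      ∏ i ∈ Finset.range (k + 1), 1 / ((n : ℝ) - 2 * i - 2) with hD
  have hD0 : 0 ≤ D := by
    refine mul_nonneg (by positivity) (Finset.prod_nonneg fun i hi => ?_)
    have hi := Finset.mem_range.1 hi
    have : ((2 * (i + 1) : ℕ) : ℝ) < n := by exact_mod_cast (by omega : 2 * (i + 1) < n)
    push_cast at this
    have : 0 < (n : ℝ) - 2 * i - 2 := by linarith
    positivity
  have hq : 0 < p / (p - 1) := div_pos (by linarith) (by linarith)
  have main : ∫⁻ x, ENNReal.ofReal (|f x| ^ p / (‖x‖ ^ (n : ℝ) * Real.log (1 / ‖x‖) ^ p)) ≤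
      ENNReal.ofReal ((p / (p - 1) * D) ^ p) * JJ p (numSeq f (k + 1)) := by
    refine (hardy_crit hn hp1 hρ hρ1 hnice).trans
      ((mul_le_mul_right (chain hn hp1 hρ hnice k hln) _).trans (le_of_eq ?_))
    rw [← mul_assoc, ← ENNReal.ofReal_mul (by positivity), abs_of_pos hq,
      ← Real.mul_rpow hq.le hD0]
  have hlog : ∀ x ∈ Metric.ball (0 : EuclideanSpace ℝ (Fin n)) 1, 0 ≤ Real.log (1 / ‖x‖) := by
    intro x hx
    rw [mem_ball_zero_iff] at hx
    rw [one_div, Real.log_inv]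
    exact neg_nonneg.2 (Real.log_nonpos (norm_nonneg x) hx.le)
  have hfc' := hf.continuous
  have hNc := hN.1.continuous
  have hpc := continuous_abs_rpow hp1
  have : Nonempty (Fin n) := ⟨⟨0, by omega⟩⟩
  have hR : ∫ x in Metric.ball (0 : EuclideanSpace ℝ (Fin n)) 1,
      |(radLap^[k + 1] f) x| ^ p / ‖x‖ ^ ((n : ℝ) - 2 * ((k + 1 : ℕ) : ℝ) * p) =
      (JJ p (numSeq f (k + 1))).toReal := by
    have e1 : ∫ x in Metric.ball (0 : EuclideanSpace ℝ (Fin n)) 1,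
        |(radLap^[k + 1] f) x| ^ p / ‖x‖ ^ ((n : ℝ) - 2 * ((k + 1 : ℕ) : ℝ) * p) =
        ∫ x in Metric.ball (0 : EuclideanSpace ℝ (Fin n)) 1,
          |numSeq f (k + 1) x| ^ p / ‖x‖ ^ (n : ℝ) := by
      refine integral_congr_ae (ae_restrict_of_ae ?_)
      filter_upwards [compl_mem_ae_iff.2 (measure_singleton (0 : EuclideanSpace ℝ (Fin n)))] with x hx
      have hx : x ≠ 0 := hx
      have hxp : 0 < ‖x‖ := norm_pos_iff.2 hx
      rw [radLap_iter hnice _ x hx, abs_mul, Real.mul_rpow (abs_nonneg _) (abs_nonneg _),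
        abs_of_pos (zpow_pos hxp _), Real.rpow_sub hxp, ← Real.rpow_intCast, ← Real.rpow_mul hxp.le]
      push_cast
      rw [neg_mul, Real.rpow_neg hxp.le]
      have := Real.rpow_pos_of_pos hxp (2 * ((k : ℝ) + 1) * p)
      field_simp
    rw [e1, setIntegral_eq_integral_of_forall_compl_eq_zero, integral_eq_lintegral_of_nonneg_ae]
    · rfl
    · exact .of_forall fun x => by positivity
    · exact ((hpc.comp hNc).measurable.div (by fun_prop)).aestronglyMeasurable
    · intro x hx
      rw [mem_ball_zero_iff, not_lt] at hx
      rw [hN.2 x (by linarith), abs_zero, Real.zero_rpow hp0, zero_div]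
  rw [hR, integral_eq_lintegral_of_nonneg_ae]
  rotate_left
  · refine (ae_restrict_iff' measurableSet_ball).2 (.of_forall fun x hx => ?_)
    have := hlog x hx
    positivity
  · exact ((hpc.comp hfc').measurable.div (by fun_prop)).aestronglyMeasurable
  have hle := (setLIntegral_le_lintegral (Metric.ball (0 : EuclideanSpace ℝ (Fin n)) 1) _).trans main
  have := ENNReal.toReal_mono (ENNReal.mul_ne_top ENNReal.ofReal_ne_top hfin) hle
  rw [ENNReal.toReal_mul, ENNReal.toReal_ofReal (by positivity)] at this
  rw [mul_assoc (p / (p - 1))]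
  exact this
end

section
/- Let n ≥ 3 and l ≥ 1 be integers and p ∈ (1, n/(2l+1)). Then for every f ∈ C_c^∞(B), ∫_B |f(x)|^p / ( |x|^n (log(1/|x|))^p ) dx ≤ ( (p/(p−1)) · (1/(2^l l!)) · ∏_{i=0}^{l−1} 1/(n−2i−2) )^p ∫_B |∂_r ( Δ_r^l f )(x)|^p / |x|^{n−(2l+1)p} dx. -/
open MeasureTheory

/-- Euclidean space, short name. -/
abbrev Eu (n : ℕ) := EuclideanSpace ℝ (Fin n)

lemma radial_zero (Φ Φ' : ℝ → ℝ) (hd : ∀ r ∈ Set.Ioo (0:ℝ) 1, HasDerivAt Φ (Φ' r) r)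
    (h0 : Filter.Tendsto Φ (nhdsWithin 0 (Set.Ioi 0)) (nhds 0))
    (h1 : Filter.Tendsto Φ (nhdsWithin 1 (Set.Iio 1)) (nhds 0)) :
    ∫ r in Set.Ioo (0:ℝ) 1, Φ' r = 0 := by
  rw [← integral_Ioc_eq_integral_Ioo, ← intervalIntegral.integral_of_le zero_le_one]
  by_cases hi : IntervalIntegrable Φ' volume 0 1
  · rw [intervalIntegral.integral_eq_sub_of_hasDerivAt_of_tendsto one_pos hd hi h0 h1]; simp
  · exact intervalIntegral.integral_undef hi

lemma polar_zero {n : ℕ} (hn : 3 ≤ n) (g : Eu n → ℝ)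
    (h : ∀ ω : Eu n, ‖ω‖ = 1 →
      ∫ r in Set.Ioo (0:ℝ) 1, r ^ (n - 1) * g (r • ω) = 0) :
    ∫ x in Metric.ball (0 : Eu n) 1, g x = 0 := by
  let μ : Measure (Eu n) := volume
  set G : (Eu n) → ℝ := (Metric.ball (0:(Eu n)) 1).indicator g with hG
  rw [← integral_indicator measurableSet_ball, ← hG]
  by_cases hi : Integrable G
  swap
  · exact integral_undef hi
  have : Nontrivial (Eu n) := by
    apply Module.nontrivial_of_finrank_pos (R := ℝ); simp; omega
  have hmp := μ.measurePreserving_homeomorphUnitSphereProd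
  have hme := Homeomorph.measurableEmbedding (homeomorphUnitSphereProd (Eu n))
  let K : (Metric.sphere (0:(Eu n)) 1) × Set.Ioi (0:ℝ) → ℝ := fun z => G (z.2.1 • z.1.1)
  have hK : ∀ x : ({(0:(Eu n))}ᶜ : Set (Eu n)), K (homeomorphUnitSphereProd (Eu n) x) = G x.1 := by
    intro x
    have : x.1 ≠ 0 := x.2
    simp [K, smul_smul, this]
  have e1 : ∫ x, G x = ∫ z, K z ∂(μ.toSphere.prod (.volumeIoiPow (Module.finrank ℝ (Eu n) - 1))) := by
    rw [← hmp.integral_comp hme]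
    simp_rw [hK]
    rw [integral_subtype_comap (measurableSet_singleton _).compl (fun x => G x),
        show μ.restrict _ = volume from restrict_compl_singleton (μ := (volume : Measure (Eu n))) 0]
  have hKi : Integrable K (μ.toSphere.prod (.volumeIoiPow (Module.finrank ℝ (Eu n) - 1))) := by
    rw [← hmp.integrable_comp_emb hme]
    have : K ∘ (homeomorphUnitSphereProd (Eu n)) = G ∘ Subtype.val := by
      ext x; exact hK x
    rw [this, ← integrableOn_iff_comap_subtypeVal (measurableSet_singleton _).compl]
    exact hi.integrableOn
  rw [e1, integral_prod _ hKi]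
  have hz : ∀ ω : Metric.sphere (0:(Eu n)) 1,
      ∫ r, K (ω, r) ∂(Measure.volumeIoiPow (Module.finrank ℝ (Eu n) - 1)) = 0 := by
    intro ω
    have hω : ‖ω.1‖ = 1 := by simpa using ω.2
    simp only [Measure.volumeIoiPow, ENNReal.ofReal]
    rw [integral_withDensity_eq_integral_smul]
    · simp only [K]
      rw [integral_subtype_comap measurableSet_Ioi
        fun a ↦ Real.toNNReal (a ^ (Module.finrank ℝ (Eu n) - 1)) • G (a • ω.1)]
      have : ∀ a ∈ Set.Ioi (0:ℝ), Real.toNNReal (a ^ (Module.finrank ℝ (Eu n) - 1)) • G (a • ω.1)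
          = (Set.Ioo (0:ℝ) 1).indicator (fun r => r ^ (n-1) * g (r • ω.1)) a := by
        intro a ha
        have ha' : 0 < a := ha
        rw [NNReal.smul_def, Real.coe_toNNReal _ (pow_nonneg ha'.le _)]
        have hf : Module.finrank ℝ (Eu n) = n := by simp
        rw [hf]
        by_cases h1 : a < 1
        · simp [hG, Set.indicator, norm_smul, hω, abs_of_pos ha', ha', h1]
        · simp [hG, Set.indicator, norm_smul, hω, abs_of_pos ha', ha', h1]
      rw [setIntegral_congr_fun measurableSet_Ioi this, setIntegral_indicator measurableSet_Ioo]
      rw [show Set.Ioi (0:ℝ) ∩ Set.Ioo 0 1 = Set.Ioo 0 1 from by ext; simp]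
      exact h _ hω
    · exact (measurable_subtype_coe.pow_const _).real_toNNReal
  simp only [hz]; simp

/-- pointwise Young -/
lemma young_aux {p : ℝ} (hp : 1 < p) {c a b : ℝ} (hc : 0 < c) (ha : 0 ≤ a) (hb : 0 ≤ b) :
    a ^ (p-1) * b ≤ c * ((1 - 1/p) * a ^ p + 1/p * (b / c) ^ p) := by
  have hpq : p.HolderConjugate (p / (p-1)) := Real.HolderConjugate.conjExponent hp
  have h := Real.young_inequality_of_nonneg (div_nonneg hb hc.le) (Real.rpow_nonneg ha (p-1)) hpq
  have hp1 : p - 1 ≠ 0 := by linarith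
  rw [← Real.rpow_mul ha, mul_div_cancel₀ _ hp1] at h
  have e : a ^ (p-1) * b = c * (b / c * a ^ (p-1)) := by field_simp
  rw [e]
  refine mul_le_mul_of_nonneg_left (h.trans_eq ?_) hc.le
  field_simp
  ring

lemma abs_rpow_aux {p : ℝ} (hp : 1 < p) (a : ℝ) : |a| ^ (p-2) * |a| = |a| ^ (p-1) := by
  rw [← Real.rpow_add_one' (abs_nonneg a) (by linarith)]; ring_nf

/-- Euler operator plus a constant. -/
noncomputable def DD {n : ℕ} (c : ℝ) (g : Eu n → ℝ) (x : Eu n) : ℝ := fderiv ℝ g x x + c * g x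

lemma DD_contDiff {n : ℕ} (c : ℝ) {g : Eu n → ℝ} (hg : ContDiff ℝ (⊤ : ℕ∞) g) :
    ContDiff ℝ (⊤ : ℕ∞) (DD c g) := by
  unfold DD
  exact ((hg.fderiv_right (m := (⊤ : ℕ∞)) (by simp)).clm_apply contDiff_id).add
    (contDiff_const.mul hg)

lemma DD_tsupport {n : ℕ} (c : ℝ) (g : Eu n → ℝ) : tsupport (DD c g) ⊆ tsupport g := by
  refine closure_minimal ?_ (isClosed_tsupport g)
  intro x hx
  by_contra h
  apply hx
  have h1 : g x = 0 := image_eq_zero_of_notMem_tsupport h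
  have h2 : fderiv ℝ g x = 0 := by
    by_contra h3
    exact h (support_fderiv_subset ℝ h3)
  simp [DD, h1, h2]

/-- Smooth, compactly supported in the ball. -/
structure Good {n : ℕ} (g : Eu n → ℝ) : Prop where
  smooth : ContDiff ℝ (⊤ : ℕ∞) g
  cpt : HasCompactSupport g
  supp : tsupport g ⊆ Metric.ball (0 : Eu n) 1

lemma Good.dd {n : ℕ} {g : Eu n → ℝ} (hg : Good g) (c : ℝ) : Good (DD c g) :=
  ⟨DD_contDiff c hg.smooth, hg.cpt.mono' ((subset_tsupport _).trans (DD_tsupport c g)),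
    (DD_tsupport c g).trans hg.supp⟩

lemma Good.out {n : ℕ} {g : Eu n → ℝ} (hg : Good g) {x : Eu n} (hx : 1 ≤ ‖x‖) : g x = 0 := by
  apply image_eq_zero_of_notMem_tsupport
  intro h
  have := hg.supp h
  simp at this
  linarith

lemma Good.bound {n : ℕ} {g : Eu n → ℝ} (hg : Good g) (h0 : g 0 = 0) :
    ∃ C, 0 ≤ C ∧ ∀ x, |g x| ≤ C * ‖x‖ := by
  obtain ⟨C, hC⟩ := hg.smooth.lipschitzWith_of_hasCompactSupport hg.cpt (by simp)
  refine ⟨C, C.2, fun x => ?_⟩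
  have := hC.norm_sub_le x 0
  simpa [h0] using this

lemma DD_deriv {n : ℕ} {g : Eu n → ℝ} (hg : Good g) (ω : Eu n) (r : ℝ) (hr : r ≠ 0) :
    HasDerivAt (fun r : ℝ => g (r • ω)) (DD 0 g (r • ω) / r) r := by
  have h1 : HasFDerivAt g (fderiv ℝ g (r • ω)) (r • ω) :=
    (hg.smooth.differentiable (by simp) _).hasFDerivAt
  have h2 : HasDerivAt (fun r : ℝ => r • ω) ((1:ℝ) • ω) r := (hasDerivAt_id r).smul_const ω
  have := h1.comp_hasDerivAt r h2
  have e : DD 0 g (r • ω) / r = (fderiv ℝ g (r • ω)) ((1:ℝ) • ω) := by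
    simp only [DD, map_smul, smul_eq_mul]
    field_simp
    ring
  rw [e]
  exact this

lemma integrable_aux {n : ℕ} (hn : 3 ≤ n) {Q : Eu n → ℝ} (hQ : Measurable Q) {s C : ℝ} (hs : 0 < s)
    (hb : ∀ x : Eu n, x ≠ 0 → ‖x‖ < 1 → |Q x| ≤ C * ‖x‖ ^ s) :
    IntegrableOn (fun x => Q x / ‖x‖ ^ (n:ℝ)) (Metric.ball (0 : Eu n) 1) := by
  refine integrableOn_ball_of_norm_le_rpow (α := n - s) (C := C) ?_ ?_ ?_ ?_
  · simp; omega
  · simp [hs]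
  · have : ∀ᵐ x : Eu n ∂(volume.restrict (Metric.ball (0 : Eu n) 1)), x ≠ 0 := by
      have : Nontrivial (Eu n) := by
        apply Module.nontrivial_of_finrank_pos (R := ℝ); simp; omega
      exact ae_restrict_of_ae (Measure.ae_ne volume 0)
    filter_upwards [this, ae_restrict_mem measurableSet_ball] with x hx hx1
    have hx0 : 0 < ‖x‖ := norm_pos_iff.2 hx
    have hx1 : ‖x‖ < 1 := by simpa using hx1
    rw [neg_sub, Real.rpow_sub hx0, norm_div, Real.norm_eq_abs, Real.norm_eq_abs,
      abs_of_pos (Real.rpow_pos_of_pos hx0 _), ← mul_div_assoc]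
    gcongr
    exact hb x hx hx1
  · exact (hQ.div (measurable_norm.pow_const _)).aestronglyMeasurable

lemma ae_ball_ne {n : ℕ} (hn : 3 ≤ n) :
    ∀ᵐ x : Eu n ∂(volume.restrict (Metric.ball (0 : Eu n) 1)), x ≠ 0 ∧ ‖x‖ < 1 := by
  have : Nontrivial (Eu n) := by
    apply Module.nontrivial_of_finrank_pos (R := ℝ); simp; omega
  filter_upwards [ae_restrict_of_ae (Measure.ae_ne volume (0 : Eu n)),
    ae_restrict_mem measurableSet_ball] with x hx hx1
  exact ⟨hx, by simpa using hx1⟩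

lemma Good.integrable {n : ℕ} (hn : 3 ≤ n) {g : Eu n → ℝ} (hg : Good g) (h0 : g 0 = 0)
    {p : ℝ} (hp : 1 < p) :
    IntegrableOn (fun x => |g x| ^ p / ‖x‖ ^ (n:ℝ)) (Metric.ball (0 : Eu n) 1) := by
  obtain ⟨C, hC0, hC⟩ := hg.bound h0
  refine integrable_aux hn (s := p) (C := C ^ p) ?_ (by linarith) ?_
  · exact (hg.smooth.continuous.measurable.abs).pow_const p
  · intro x hx hx1
    rw [abs_of_nonneg (by positivity), ← Real.mul_rpow hC0 (norm_nonneg x)]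
    exact Real.rpow_le_rpow (abs_nonneg _) (hC x) (by linarith)

lemma pow_aux {n : ℕ} (hn : 3 ≤ n) {r : ℝ} (hr : 0 < r) (a : ℝ) :
    r ^ (n - 1) * (a / r ^ (n:ℝ)) = a / r := by
  obtain ⟨m, rfl⟩ : ∃ m, n = m + 1 := ⟨n - 1, by omega⟩
  rw [Real.rpow_natCast, pow_succ]
  simp
  field_simp

lemma step {n : ℕ} (hn : 3 ≤ n) {g : Eu n → ℝ} (hg : Good g) (h0 : g 0 = 0)
    {p : ℝ} (hp : 1 < p) {c : ℝ} (hc : c ≠ 0) :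
    ∫ x in Metric.ball (0 : Eu n) 1, |g x| ^ p / ‖x‖ ^ (n:ℝ) ≤
      (1 / |c|) ^ p * ∫ x in Metric.ball (0 : Eu n) 1, |DD c g x| ^ p / ‖x‖ ^ (n:ℝ) := by
  set Q : Eu n → ℝ := fun x => p * |g x| ^ (p-2) * g x * DD 0 g x with hQ
  have hgm := hg.smooth.continuous.measurable
  have hQm : Measurable Q := by
    have := (hg.dd 0).smooth.continuous.measurable
    exact ((measurable_const.mul (hgm.abs.pow_const _)).mul hgm).mul this
  have hd0 : ∀ c, DD c g 0 = 0 := fun c => by simp [DD, h0]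
  have hQi : IntegrableOn (fun x => Q x / ‖x‖ ^ (n:ℝ)) (Metric.ball (0 : Eu n) 1) := by
    obtain ⟨C, hC0, hC⟩ := hg.bound h0
    obtain ⟨C', hC0', hC'⟩ := (hg.dd 0).bound (hd0 0)
    refine integrable_aux hn (s := p) (C := p * C ^ (p-1) * C') hQm (by linarith) ?_
    intro x hx hx1
    have hx0 : 0 < ‖x‖ := norm_pos_iff.2 hx
    have : |Q x| = p * |g x| ^ (p-1) * |DD 0 g x| := by
      rw [← abs_rpow_aux hp]
      simp only [hQ, abs_mul]
      rw [abs_of_pos (by linarith : 0 < p), abs_of_nonneg (Real.rpow_nonneg (abs_nonneg _) _)]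
      ring
    rw [this]
    calc p * |g x| ^ (p-1) * |DD 0 g x| ≤ p * (C * ‖x‖) ^ (p-1) * (C' * ‖x‖) := by
          have := hC x
          have := hC' x
          have : 0 ≤ p - 1 := by linarith
          gcongr
      _ = p * C ^ (p-1) * C' * (‖x‖ ^ (p-1) * ‖x‖) := by
          rw [Real.mul_rpow hC0 hx0.le]; ring
      _ = _ := by
          rw [← Real.rpow_add_one hx0.ne']; ring_nf
  have hQ0 : ∫ x in Metric.ball (0 : Eu n) 1, Q x / ‖x‖ ^ (n:ℝ) = 0 := by
    apply polar_zero hn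
    intro ω hω
    have e : ∀ r ∈ Set.Ioo (0:ℝ) 1, r ^ (n-1) * (Q (r • ω) / ‖r • ω‖ ^ (n:ℝ)) = Q (r • ω) / r := by
      intro r hr
      rw [norm_smul, hω, Real.norm_eq_abs, abs_of_pos hr.1, mul_one, pow_aux hn hr.1]
    rw [setIntegral_congr_fun measurableSet_Ioo e]
    have hcont : Continuous (fun r : ℝ => |g (r • ω)| ^ p) := by
      have := hg.smooth.continuous
      exact Continuous.rpow_const (by fun_prop) (fun _ => Or.inr (by linarith))
    refine radial_zero (fun r => |g (r • ω)| ^ p) _ ?_ ?_ ?_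
    · intro r hr
      have := (hasDerivAt_abs_rpow (g (r • ω)) hp).comp r (DD_deriv hg ω r hr.1.ne')
      have e : Q (r • ω) / r =
          p * |g (r • ω)| ^ (p - 2) * g (r • ω) * (DD 0 g (r • ω) / r) := by
        simp only [hQ]; ring
      rw [e]
      exact this
    · have := (hcont.tendsto 0).mono_left (nhdsWithin_le_nhds (s := Set.Ioi 0))
      simpa [h0, Real.zero_rpow (by linarith : p ≠ 0)] using this
    · have := (hcont.tendsto 1).mono_left (nhdsWithin_le_nhds (s := Set.Iio 1))
      simpa [hg.out hω.ge, Real.zero_rpow (by linarith : p ≠ 0)] using this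
  have hpt : ∀ x : Eu n, |g x| ^ p ≤ (1/|c|) ^ p * |DD c g x| ^ p - 1 / c * Q x := by
    intro x
    have hc' : 0 < |c| := abs_pos.2 hc
    have hy := young_aux hp hc' (abs_nonneg (g x)) (abs_nonneg (DD c g x))
    have h1 : |g x| ^ p = |g x| ^ (p-2) * g x * g x := by
      have : |g x| ^ p = |g x| ^ (p-1) * |g x| := by
        rw [← Real.rpow_add_one' (abs_nonneg _) (by linarith)]; ring_nf
      rw [this, ← abs_rpow_aux hp, mul_assoc, abs_mul_abs_self]; ring
    have h2 : |c| * |g x| ^ p + |c| / c * (Q x / p) =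
        |c| / c * (|g x| ^ (p-2) * g x * DD c g x) := by
      have hDD : DD c g x = DD 0 g x + c * g x := by simp [DD]
      rw [h1, hDD]
      simp only [hQ]
      field_simp
      ring
    have h3 : |c| / c * (|g x| ^ (p-2) * g x * DD c g x) ≤ |g x| ^ (p-1) * |DD c g x| := by
      refine (le_abs_self _).trans ?_
      rw [abs_mul, abs_div, abs_abs, div_self hc'.ne', one_mul, abs_mul, abs_mul,
        abs_of_nonneg (Real.rpow_nonneg (abs_nonneg _) _), abs_rpow_aux hp]
    have h4 : (|DD c g x| / |c|) ^ p = (1/|c|) ^ p * |DD c g x| ^ p := by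
      rw [← Real.mul_rpow (by positivity) (abs_nonneg _)]; congr 1; ring
    rw [h4] at hy
    have h5 : |c| * |g x| ^ p + |c| / c * (Q x / p) ≤
      |c| * ((1 - 1 / p) * |g x| ^ p + 1 / p * ((1/|c|) ^ p * |DD c g x| ^ p)) :=
      (h2.le.trans h3).trans hy
    have h6 : |c| / p * (|g x| ^ p + 1 / c * Q x) ≤ |c| / p * ((1/|c|) ^ p * |DD c g x| ^ p) := by
      have e1 : |c| / p * (|g x| ^ p + 1 / c * Q x) = |c| * |g x| ^ p + |c| / c * (Q x / p)
          - |c| * ((1 - 1 / p) * |g x| ^ p) := by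
        have : p ≠ 0 := by linarith
        field_simp
        ring
      rw [e1]
      linarith [h5, show |c| / p * ((1/|c|) ^ p * |DD c g x| ^ p) = |c| * (1 / p * ((1/|c|) ^ p * |DD c g x| ^ p)) by ring, mul_add |c| ((1 - 1 / p) * |g x| ^ p) (1 / p * ((1/|c|) ^ p * |DD c g x| ^ p))]
    have h7 := le_of_mul_le_mul_left h6 (by positivity)
    linarith
  have hDi := (hg.dd c).integrable hn (hd0 c) hp
  calc ∫ x in Metric.ball (0 : Eu n) 1, |g x| ^ p / ‖x‖ ^ (n:ℝ)
      ≤ ∫ x in Metric.ball (0 : Eu n) 1, ((1/|c|) ^ p * (|DD c g x| ^ p / ‖x‖ ^ (n:ℝ))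
        - 1 / c * (Q x / ‖x‖ ^ (n:ℝ))) := by
        refine integral_mono (hg.integrable hn h0 hp) ((hDi.const_mul _).sub (hQi.const_mul _)) ?_
        intro x
        have := div_le_div_of_nonneg_right (hpt x) (Real.rpow_nonneg (norm_nonneg x) (n:ℝ))
        refine this.trans_eq ?_
        simp only
        ring
    _ = _ := by
        rw [integral_sub (hDi.const_mul _) (hQi.const_mul _), integral_const_mul,
          integral_const_mul, hQ0]
        ring

lemma radDeriv_form {n : ℕ} {u h : Eu n → ℝ} (m : ℕ) (hu : ∀ x, x ≠ 0 → u x = h x / ‖x‖ ^ m)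
    (hh : ContDiff ℝ (⊤ : ℕ∞) h) (x : Eu n) (hx : x ≠ 0) :
    radDeriv u x = DD (-m) h x / ‖x‖ ^ (m+1) := by
  have hev : u =ᶠ[nhds x] fun y => h y / ‖y‖ ^ m := by
    filter_upwards [isOpen_ne.mem_nhds hx] with y hy using hu y hy
  have hx0 : 0 < ‖x‖ := norm_pos_iff.2 hx
  unfold radDeriv
  rw [hev.fderiv_eq]
  have hnd : DifferentiableAt ℝ (fun y : Eu n => ‖y‖) x := differentiableAt_id.norm ℝ hx
  have hN := hnd.hasFDerivAt
  have hH := (hh.differentiable (by simp) x).hasFDerivAt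
  have hself := hnd.fderiv_norm_self
  have hmul : h =ᶠ[nhds x] fun y => (h y / ‖y‖ ^ m) * ‖y‖ ^ m := by
    filter_upwards [isOpen_ne.mem_nhds hx] with y hy
    have : ‖y‖ ≠ 0 := norm_ne_zero_iff.2 hy
    field_simp
  have hd : DifferentiableAt ℝ (fun y => h y / ‖y‖ ^ m) x := by
    simp only [div_eq_mul_inv]
    exact (hh.differentiable (by simp) x).mul ((hnd.pow m).inv (pow_ne_zero m hx0.ne'))
  have hp := (hd.hasFDerivAt.mul (hN.pow m)).congr_of_eventuallyEq hmul
  have := congrArg (fun L => L x) (hH.unique hp)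
  simp [hself] at this
  rw [map_smul, smul_eq_mul]
  simp only [DD]
  rw [this]
  rcases m with _ | m
  · simp; field_simp
  · simp
    field_simp
    ring

lemma radLap_form {n : ℕ} {u h : Eu n → ℝ} (m : ℕ) (hu : ∀ x, x ≠ 0 → u x = h x / ‖x‖ ^ m)
    (hh : ContDiff ℝ (⊤ : ℕ∞) h) (x : Eu n) (hx : x ≠ 0) :
    radLap u x = DD (n - 2 - m) (DD (-m) h) x / ‖x‖ ^ (m+2) := by
  have h1 := radDeriv_form m hu hh
  have h2 := radDeriv_form (m+1) h1 (DD_contDiff _ hh) x hx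
  have hx0 : 0 < ‖x‖ := norm_pos_iff.2 hx
  unfold radLap
  rw [h2, h1 x hx]
  generalize DD (-m) h = k
  simp only [DD]
  push_cast
  field_simp
  ring

/-- Numerators of the iterated radial Laplacians. -/
noncomputable def hk {n : ℕ} (f : Eu n → ℝ) : ℕ → Eu n → ℝ
  | 0 => f
  | k+1 => DD (n - 2 - 2 * k) (DD (-(2 * k)) (hk f k))

lemma hk_good {n : ℕ} {f : Eu n → ℝ} (hf : Good f) (k : ℕ) : Good (hk f k) := by
  induction k with
  | zero => exact hf
  | succ k ih => exact (ih.dd _).dd _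

lemma hk_zero {n : ℕ} (f : Eu n → ℝ) (k : ℕ) : DD (-(2 * k)) (hk f k) 0 = 0 := by
  induction k with
  | zero => simp [DD]
  | succ k ih => simp [hk, DD] at ih ⊢; simp [ih]

lemma hk_iter {n : ℕ} {f : Eu n → ℝ} (hf : Good f) (k : ℕ) :
    ∀ x, x ≠ 0 → (radLap^[k] f) x = hk f k x / ‖x‖ ^ (2 * k) := by
  induction k with
  | zero => simp [hk]
  | succ k ih =>
    intro x hx
    rw [Function.iterate_succ_apply', radLap_form (2*k) ih (hk_good hf k).smooth x hx]
    simp [hk, mul_add]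

lemma hardy {n : ℕ} (hn : 3 ≤ n) {f : Eu n → ℝ} (hf : Good f) {p : ℝ} (hp : 1 < p) :
    ∫ x in Metric.ball (0 : Eu n) 1, |f x| ^ p / (‖x‖ ^ (n:ℝ) * Real.log (1 / ‖x‖) ^ p) ≤
      (p / (p - 1)) ^ p * ∫ x in Metric.ball (0 : Eu n) 1, |DD 0 f x| ^ p / ‖x‖ ^ (n:ℝ) := by
  set J : Eu n → ℝ := fun x => |f x| ^ p / (‖x‖ ^ (n:ℝ) * Real.log (1 / ‖x‖) ^ p) with hJ
  have hd0 : DD 0 f 0 = 0 := by simp [DD]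
  have hDi := (hf.dd 0).integrable hn hd0 hp
  by_cases hJi : IntegrableOn J (Metric.ball (0 : Eu n) 1)
  swap
  · rw [integral_undef hJi]
    have : 0 ≤ p / (p-1) := div_nonneg (by linarith) (by linarith)
    refine mul_nonneg (Real.rpow_nonneg this _) (integral_nonneg fun x => ?_)
    positivity
  obtain ⟨ρ, ⟨hρ0, hρ1⟩, hρ⟩ := exists_pos_lt_subset_ball one_pos (isClosed_tsupport f) hf.supp
  have hfρ : ∀ x : Eu n, ρ ≤ ‖x‖ → f x = 0 := by
    intro x hx
    apply image_eq_zero_of_notMem_tsupport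
    intro h
    have := hρ h
    simp at this
    linarith
  set R : Eu n → ℝ := fun x => |f x| ^ (p-2) * f x * DD 0 f x * Real.log (1 / ‖x‖) ^ (1-p) with hR
  have hfm := hf.smooth.continuous.measurable
  have hRm : Measurable R := by
    have h1 := (hf.dd 0).smooth.continuous.measurable
    have h2 : Measurable (fun x : Eu n => Real.log (1 / ‖x‖) ^ (1-p)) :=
      (Real.measurable_log.comp (measurable_const.div measurable_norm)).pow_const _
    exact (((hfm.abs.pow_const _).mul hfm).mul h1).mul h2
  have hRi : IntegrableOn (fun x => R x / ‖x‖ ^ (n:ℝ)) (Metric.ball (0 : Eu n) 1) := by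
    obtain ⟨C, hC0, hC⟩ := (hf.dd 0).bound hd0
    obtain ⟨M, hM⟩ := hf.cpt.exists_bound_of_continuous hf.smooth.continuous
    have hδ : 0 < Real.log (1 / ρ) := Real.log_pos (by rw [lt_div_iff₀ hρ0]; linarith)
    have hM0 : 0 ≤ M := (norm_nonneg _).trans (hM 0)
    refine integrable_aux hn (s := 1) (C := M ^ (p-1) * C * Real.log (1/ρ) ^ (1-p)) hRm one_pos ?_
    intro x hx hx1
    have hx0 : 0 < ‖x‖ := norm_pos_iff.2 hx
    rw [Real.rpow_one]
    by_cases hxρ : ρ ≤ ‖x‖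
    · simp only [hR, hfρ x hxρ, mul_zero, zero_mul, abs_zero]
      positivity
    · have hL : Real.log (1/ρ) ≤ Real.log (1 / ‖x‖) := by
        apply Real.log_le_log (by positivity)
        exact one_div_le_one_div_of_le hx0 (not_le.1 hxρ).le
      have hLp : Real.log (1 / ‖x‖) ^ (1-p) ≤ Real.log (1/ρ) ^ (1-p) :=
        Real.rpow_le_rpow_of_nonpos hδ hL (by linarith)
      have hL0 : 0 ≤ Real.log (1 / ‖x‖) ^ (1-p) := Real.rpow_nonneg (hδ.le.trans hL) _
      have : |R x| = |f x| ^ (p-1) * |DD 0 f x| * Real.log (1 / ‖x‖) ^ (1-p) := by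
        rw [← abs_rpow_aux hp]
        simp only [hR, abs_mul]
        rw [abs_of_nonneg hL0, abs_of_nonneg (Real.rpow_nonneg (abs_nonneg _) _)]
      rw [this]
      have h1 := hC x
      have h2 : |f x| ≤ M := hM x
      have h3 : 0 ≤ p - 1 := by linarith
      calc _ ≤ M ^ (p-1) * (C * ‖x‖) * Real.log (1/ρ) ^ (1-p) := by gcongr
        _ = _ := by ring
  set W : Eu n → ℝ := fun x => p * (R x / ‖x‖ ^ (n:ℝ)) + (p-1) * J x with hW
  have hWi : IntegrableOn W (Metric.ball (0 : Eu n) 1) :=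
    (hRi.const_mul p).add (hJi.const_mul (p-1))
  have hW0 : ∫ x in Metric.ball (0 : Eu n) 1, W x = 0 := by
    apply polar_zero hn
    intro ω hω
    have e : ∀ r ∈ Set.Ioo (0:ℝ) 1, r ^ (n-1) * W (r • ω) =
        p * |f (r • ω)| ^ (p - 2) * f (r • ω) * (DD 0 f (r • ω) / r) * (-Real.log r) ^ (1-p)
        + |f (r • ω)| ^ p * (-(r⁻¹) * (1-p) * (-Real.log r) ^ (1-p-1)) := by
      intro r hr
      have hnorm : ‖r • ω‖ = r := by
        rw [norm_smul, hω, Real.norm_eq_abs, abs_of_pos hr.1, mul_one]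
      have hL : 0 < -Real.log r := by linarith [Real.log_neg hr.1 hr.2]
      have hW' : W (r • ω) = (p * R (r • ω) + (p-1) * (|f (r • ω)| ^ p / (-Real.log r) ^ p))
          / r ^ (n:ℝ) := by
        simp only [hW, hJ, hnorm, one_div, Real.log_inv]
        have : 0 < r ^ (n:ℝ) := Real.rpow_pos_of_pos hr.1 _
        have : 0 < (-Real.log r) ^ p := Real.rpow_pos_of_pos hL _
        field_simp
      rw [hW', pow_aux hn hr.1]
      have e1 : (-Real.log r) ^ (1-p-1) = ((-Real.log r) ^ p)⁻¹ := by
        rw [← Real.rpow_neg hL.le]; congr 1; ring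
      rw [e1]
      simp only [hR, hnorm, one_div, Real.log_inv]
      have := hr.1
      ring
    rw [setIntegral_congr_fun measurableSet_Ioo e]
    refine radial_zero (fun r => |f (r • ω)| ^ p * (-Real.log r) ^ (1-p)) _ ?_ ?_ ?_
    · intro r hr
      have hL : 0 < -Real.log r := by linarith [Real.log_neg hr.1 hr.2]
      have h1 := (hasDerivAt_abs_rpow (f (r • ω)) hp).comp r (DD_deriv hf ω r hr.1.ne')
      have h2 := (Real.hasDerivAt_log hr.1.ne').neg.rpow_const (p := 1-p) (Or.inl hL.ne')
      exact h1.mul h2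
    · have h1 : Filter.Tendsto (fun r : ℝ => |f (r • ω)| ^ p) (nhdsWithin 0 (Set.Ioi 0))
          (nhds (|f ((0:ℝ) • ω)| ^ p)) := by
        have hcont : Continuous (fun r : ℝ => |f (r • ω)| ^ p) := by
          have := hf.smooth.continuous
          exact Continuous.rpow_const (by fun_prop) (fun _ => Or.inr (by linarith))
        exact (hcont.tendsto 0).mono_left nhdsWithin_le_nhds
      have h2 : Filter.Tendsto (fun r : ℝ => (-Real.log r) ^ (1-p)) (nhdsWithin 0 (Set.Ioi 0))
          (nhds 0) := by
        have h3 : Filter.Tendsto (fun r : ℝ => -Real.log r) (nhdsWithin 0 (Set.Ioi 0))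
            Filter.atTop := Filter.tendsto_neg_atBot_atTop.comp Real.tendsto_log_nhdsGT_zero
        have h4 := (tendsto_rpow_neg_atTop (y := p - 1) (by linarith)).comp h3
        simpa [Function.comp_def] using h4
      simpa using h1.mul h2
    · refine tendsto_const_nhds.congr' ?_
      have : Set.Ioo ρ 1 ∈ nhdsWithin (1:ℝ) (Set.Iio 1) := Ioo_mem_nhdsLT hρ1
      filter_upwards [this] with r hr
      have : f (r • ω) = 0 := by
        apply hfρ
        rw [norm_smul, hω, mul_one, Real.norm_eq_abs]
        exact hr.1.le.trans (le_abs_self r)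
      simp [this, Real.zero_rpow (by linarith : p ≠ 0)]
  have hpt : ∀ x : Eu n, x ≠ 0 → ‖x‖ < 1 →
      J x ≤ (p/(p-1)) ^ p * (|DD 0 f x| ^ p / ‖x‖ ^ (n:ℝ)) + p/(p-1) * W x := by
    intro x hx hx1
    have hx0 : 0 < ‖x‖ := norm_pos_iff.2 hx
    have hL : 0 < Real.log (1 / ‖x‖) := Real.log_pos (by rw [lt_div_iff₀ hx0]; linarith)
    have hp0 : 0 < p - 1 := by linarith
    have hy := young_aux hp (c := (p-1)/p) (by positivity) (div_nonneg (abs_nonneg (f x)) hL.le)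
      (abs_nonneg (DD 0 f x))
    have hY : (|DD 0 f x| / ((p-1)/p)) ^ p = (p/(p-1)) ^ p * |DD 0 f x| ^ p := by
      rw [← Real.mul_rpow (by positivity) (abs_nonneg _)]; congr 1; field_simp
    have hA : (|f x| / Real.log (1 / ‖x‖)) ^ (p-1) =
        |f x| ^ (p-1) * Real.log (1 / ‖x‖) ^ (1-p) := by
      rw [Real.div_rpow (abs_nonneg _) hL.le, div_eq_mul_inv, ← Real.rpow_neg hL.le, neg_sub]
    have hR' : -R x ≤ (|f x| / Real.log (1 / ‖x‖)) ^ (p-1) * |DD 0 f x| := by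
      refine (neg_le_abs _).trans_eq ?_
      rw [hA, ← abs_rpow_aux hp]
      simp only [hR, abs_mul]
      rw [abs_of_nonneg (Real.rpow_nonneg hL.le _),
        abs_of_nonneg (Real.rpow_nonneg (abs_nonneg _) _)]
      ring
    rw [hY] at hy
    have hJ' : J x = (|f x| / Real.log (1 / ‖x‖)) ^ p / ‖x‖ ^ (n:ℝ) := by
      simp only [hJ]
      rw [Real.div_rpow (abs_nonneg _) hL.le, div_div, mul_comm]
    have h1 := hR'.trans hy
    simp only [hW]
    rw [hJ']
    generalize (|f x| / Real.log (1 / ‖x‖)) ^ p = A at *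
    generalize (p/(p-1)) ^ p = q at *
    generalize |DD 0 f x| ^ p = D at *
    have hN : 0 < ‖x‖ ^ (n:ℝ) := Real.rpow_pos_of_pos hx0 _
    have h2 : A ≤ q * D + p/(p-1) * (p * R x + (p-1) * A) := by
      have h3 := mul_le_mul_of_nonneg_left h1 (by positivity : 0 ≤ p * (p / (p-1)))
      have e1 : p * (p / (p-1)) * ((p - 1) / p * ((1 - 1 / p) * A + 1 / p * (q * D)))
          = (p-1) * A + q * D := by field_simp
      have e2 : p/(p-1) * (p * R x + (p-1) * A) = - (p * (p / (p-1)) * (-R x)) + p * A := by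
        field_simp
      rw [e2]
      linarith
    have h3 := div_le_div_of_nonneg_right h2 hN.le
    refine h3.trans_eq ?_
    ring
  calc ∫ x in Metric.ball (0 : Eu n) 1, J x
      ≤ ∫ x in Metric.ball (0 : Eu n) 1, ((p/(p-1)) ^ p * (|DD 0 f x| ^ p / ‖x‖ ^ (n:ℝ))
        + p/(p-1) * W x) := by
        refine integral_mono_ae hJi ((hDi.const_mul _).add (hWi.const_mul _)) ?_
        filter_upwards [ae_ball_ne hn] with x hx
        exact hpt x hx.1 hx.2
    _ = _ := by
        rw [integral_add (hDi.const_mul _) (hWi.const_mul _), integral_const_mul,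
          integral_const_mul, hW0]
        ring

lemma chain_s14 {n : ℕ} (hn : 3 ≤ n) {f : Eu n → ℝ} (hf : Good f) {p : ℝ} (hp : 1 < p) (l : ℕ)
    (hl : 2 * l < n) :
    ∫ x in Metric.ball (0 : Eu n) 1, |DD 0 f x| ^ p / ‖x‖ ^ (n:ℝ) ≤
      ((1 / ((2 : ℝ) ^ l * l.factorial)) * ∏ i ∈ Finset.range l, 1 / ((n : ℝ) - 2 * i - 2)) ^ p *
      ∫ x in Metric.ball (0 : Eu n) 1, |DD (-(2 * l)) (hk f l) x| ^ p / ‖x‖ ^ (n:ℝ) := by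
  induction l with
  | zero => simp [hk]
  | succ l ih =>
    have hln : (2 * l + 2 : ℝ) < n := by exact_mod_cast (by omega : 2 * l + 2 < n)
    have hg := (hk_good hf l).dd (-(2*l))
    have h0 := hk_zero f l
    have s1 := step hn hg h0 hp (c := (n:ℝ) - 2 - 2 * l) (by linarith)
    have h0' : DD ((n:ℝ) - 2 - 2 * l) (DD (-(2 * l)) (hk f l)) 0 = 0 := by
      simp only [DD] at h0 ⊢; simp at h0 ⊢; simp [h0]
    have s2 := step hn (hg.dd ((n:ℝ) - 2 - 2 * l)) h0' hp (c := -(2 * (l+1 : ℕ))) (by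
      push_cast
      have : (0:ℝ) ≤ l := by positivity
      linarith)
    have hprod : 0 ≤ ∏ i ∈ Finset.range l, 1 / ((n : ℝ) - 2 * i - 2) := by
      apply Finset.prod_nonneg
      intro i hi
      have : (i:ℝ) ≤ l := by exact_mod_cast (Finset.mem_range.1 hi).le
      apply one_div_nonneg.2
      linarith
    have i1 := ih (by omega)
    have hc1 : |(n:ℝ) - 2 - 2 * l| = n - 2 * l - 2 := by
      rw [abs_of_pos (by linarith)]; ring
    have hc2 : |-(2 * ((l+1 : ℕ) : ℝ))| = 2 * (l+1) := by
      rw [abs_neg, abs_of_nonneg (by positivity)]; push_cast; ring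
    rw [hc1] at s1
    rw [hc2] at s2
    have hpos : (0:ℝ) < n - 2 * l - 2 := by linarith
    set P := ∏ i ∈ Finset.range l, 1 / ((n : ℝ) - 2 * i - 2) with hP
    have hco : ((1 / ((2 : ℝ) ^ (l+1) * (l+1).factorial)) *
        ∏ i ∈ Finset.range (l+1), 1 / ((n : ℝ) - 2 * i - 2)) ^ p =
        ((1 / ((2 : ℝ) ^ l * l.factorial)) * P) ^ p *
          ((1 / ((n:ℝ) - 2 * l - 2)) ^ p * (1 / (2 * ((l:ℝ)+1))) ^ p) := by
      rw [← Real.mul_rpow (by positivity) (by positivity),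
        ← Real.mul_rpow (by positivity) (by positivity), Finset.prod_range_succ, ← hP,
        Nat.factorial_succ]
      congr 1
      push_cast
      field_simp
      ring
    rw [hco, mul_assoc, mul_assoc]
    refine i1.trans (mul_le_mul_of_nonneg_left ?_ (by positivity))
    exact s1.trans (mul_le_mul_of_nonneg_left s2 (by positivity))

/-- Euclidean case of the critical higher-order Rellich inequality, Theorem 4.6 (ii). -/
theorem critical_rellich_radial_higher_odd (n l : ℕ) (hn : 3 ≤ n) (hl : 1 ≤ l) (p : ℝ)
    (hp1 : 1 < p) (hpn : p < n / (2 * l + 1))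
    (f : EuclideanSpace ℝ (Fin n) → ℝ) (hf : ContDiff ℝ (⊤ : ℕ∞) f) (hfc : HasCompactSupport f)
    (hsupp : tsupport f ⊆ Metric.ball (0 : EuclideanSpace ℝ (Fin n)) 1) :
    ∫ x in Metric.ball (0 : EuclideanSpace ℝ (Fin n)) 1,
        |f x| ^ p / (‖x‖ ^ (n : ℝ) * Real.log (1 / ‖x‖) ^ p) ≤
      (p / (p - 1) * (1 / ((2 : ℝ) ^ l * l.factorial)) *
          ∏ i ∈ Finset.range l, 1 / ((n : ℝ) - 2 * i - 2)) ^ p *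
        ∫ x in Metric.ball (0 : EuclideanSpace ℝ (Fin n)) 1,
          |radDeriv (radLap^[l] f) x| ^ p / ‖x‖ ^ ((n : ℝ) - (2 * l + 1) * p) := by
  have hG : Good f := ⟨hf, hfc, hsupp⟩
  have hln : (2 * l + 1 : ℝ) < n := by
    have h1 : 1 < (n:ℝ) / (2 * l + 1) := hp1.trans hpn
    rwa [lt_div_iff₀ (by positivity), one_mul] at h1
  have hln' : 2 * l + 1 < n := by exact_mod_cast hln
  have hp0 : 0 < p - 1 := by linarith
  have hprod : 0 ≤ ∏ i ∈ Finset.range l, 1 / ((n : ℝ) - 2 * i - 2) := by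
    apply Finset.prod_nonneg
    intro i hi
    have : (i:ℝ) + 1 ≤ l := by exact_mod_cast (Finset.mem_range.1 hi)
    apply one_div_nonneg.2
    linarith
  have hR : ∫ x in Metric.ball (0 : EuclideanSpace ℝ (Fin n)) 1,
        |radDeriv (radLap^[l] f) x| ^ p / ‖x‖ ^ ((n : ℝ) - (2 * l + 1) * p) =
      ∫ x in Metric.ball (0 : Eu n) 1, |DD (-(2 * l)) (hk f l) x| ^ p / ‖x‖ ^ (n:ℝ) := by
    refine integral_congr_ae ?_
    filter_upwards [ae_ball_ne hn] with x hx
    have hx0 : 0 < ‖x‖ := norm_pos_iff.2 hx.1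
    rw [radDeriv_form (2*l) (hk_iter hG l) (hk_good hG l).smooth x hx.1]
    rw [abs_div, abs_of_pos (pow_pos hx0 _), Real.div_rpow (abs_nonneg _) (by positivity),
      ← Real.rpow_natCast, ← Real.rpow_mul hx0.le, div_div, ← Real.rpow_add hx0]
    push_cast
    congr 2
    ring
  rw [hR, mul_assoc (p / (p-1)), Real.mul_rpow (by positivity) (by positivity), mul_assoc]
  exact (hardy hn hG hp1).trans
    (mul_le_mul_of_nonneg_left (chain_s14 hn hG hp1 l (by omega)) (by positivity))
end

section
/- Let n ≥ 3 be an integer and β < n − 4 a real number. Then for every smooth compactly supported function F : ℝ → ℝ, ∫_0^∞ F'(ρ)² ρ^{−β} (sinh ρ)^{n−3} dρ ≥ ((n−β−4)²/4) ∫_0^∞ F(ρ)² ρ^{−β} (sinh ρ)^{n−5} dρ. -/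
open MeasureTheory

lemma hardy_core (w b P P' F : ℝ → ℝ) (c : ℝ) (hc : 0 < c)
    (hF : ContDiff ℝ (⊤ : ℕ∞) F) (hFc : HasCompactSupport F)
    (hw : ContinuousOn w (Set.Ioi 0)) (hb : ContinuousOn b (Set.Ioi 0))
    (hP' : ContinuousOn P' (Set.Ioi 0))
    (hd : ∀ x, 0 < x → HasDerivAt P (P' x) x)
    (hw0 : ∀ x, 0 < x → 0 < w x) (hP0 : ∀ x, 0 < x → 0 ≤ P x)
    (hineq : ∀ x, 0 < x → c * b x + c * (P x ^ 2 / w x) ≤ P' x)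
    (hA : IntegrableOn (fun x => deriv F x ^ 2 * w x) (Set.Ioi 0)) :
    c ^ 2 * ∫ x in Set.Ioi (0 : ℝ), F x ^ 2 * b x ≤ ∫ x in Set.Ioi (0 : ℝ), deriv F x ^ 2 * w x := by
  have hFd : Differentiable ℝ F := hF.differentiable (by simp)
  have hF' : Continuous (deriv F) := hF.continuous_deriv (by simp)
  have hFct : Continuous F := hF.continuous
  have hAnn : 0 ≤ᵐ[volume.restrict (Set.Ioi (0:ℝ))] (fun x => deriv F x ^ 2 * w x) := by
    filter_upwards [ae_restrict_mem measurableSet_Ioi] with x hx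
    exact mul_nonneg (sq_nonneg _) (hw0 x hx).le
  by_cases hB : IntegrableOn (fun x => F x ^ 2 * b x) (Set.Ioi 0)
  swap
  · rw [integral_undef hB, mul_zero]
    exact integral_nonneg_of_ae hAnn
  obtain ⟨R, hR0, hR⟩ : ∃ R : ℝ, 0 < R ∧ ∀ x, R ≤ x → F x = 0 := by
    obtain ⟨r, hr⟩ := hFc.isCompact.isBounded.subset_closedBall (0:ℝ)
    refine ⟨max r 0 + 1, by positivity, fun x hx => ?_⟩
    by_contra h
    have := hr (subset_tsupport F h)
    rw [Metric.mem_closedBall, dist_zero_right, Real.norm_eq_abs] at this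
    have := le_abs_self x
    have := le_max_left r 0
    linarith
  have key : ∀ ε, 0 < ε → ε < R →
      c ^ 2 * ∫ x in Set.Ioc ε R, F x ^ 2 * b x ≤ ∫ x in Set.Ioi (0 : ℝ), deriv F x ^ 2 * w x := by
    intro ε he heR
    have hsub : Set.uIcc ε R ⊆ Set.Ioi 0 := by
      rw [Set.uIcc_of_le heR.le]; intro x hx; exact lt_of_lt_of_le he hx.1
    have hPc : ContinuousOn P (Set.Ioi 0) := fun x hx => (hd x hx).continuousAt.continuousWithinAt
    have iA : IntervalIntegrable (fun x => deriv F x ^ 2 * w x) volume ε R :=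
      (((hF'.pow 2).continuousOn).mul (hw.mono hsub)).intervalIntegrable
    have iB : IntervalIntegrable (fun x => F x ^ 2 * b x) volume ε R :=
      (((hFct.pow 2).continuousOn).mul (hb.mono hsub)).intervalIntegrable
    have iD : IntervalIntegrable (fun x => (2 * F x * deriv F x) * P x + F x ^ 2 * P' x) volume ε R :=
      ((((continuous_const.mul hFct).mul hF').continuousOn.mul (hPc.mono hsub)).add
        ((hFct.pow 2).continuousOn.mul (hP'.mono hsub))).intervalIntegrable
    have hD : ∫ x in ε..R, ((2 * F x * deriv F x) * P x + F x ^ 2 * P' x)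
        = F R ^ 2 * P R - F ε ^ 2 * P ε := by
      refine intervalIntegral.integral_eq_sub_of_hasDerivAt (f := fun x => F x ^ 2 * P x) ?_ iD
      intro x hx
      have h1 := ((hFd x).hasDerivAt.pow 2).mul (hd x (hsub hx))
      refine h1.congr_deriv ?_
      simp
    have hnn : 0 ≤ ∫ x in ε..R, ((deriv F x ^ 2 * w x
        + c * ((2 * F x * deriv F x) * P x + F x ^ 2 * P' x)) - c ^ 2 * (F x ^ 2 * b x)) := by
      refine intervalIntegral.integral_nonneg heR.le ?_
      intro x hx
      have hx0 : 0 < x := lt_of_lt_of_le he hx.1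
      have h1 := hineq x hx0
      have h2 := hw0 x hx0
      have h3 : 0 ≤ w x * (deriv F x + c * F x * P x / w x) ^ 2 := by positivity
      have h4 : w x * (deriv F x + c * F x * P x / w x) ^ 2
          = deriv F x ^ 2 * w x + c * (2 * F x * deriv F x * P x) + c ^ 2 * F x ^ 2 * (P x ^ 2 / w x) := by
        field_simp
        ring
      have h5 := mul_le_mul_of_nonneg_left h1 (show 0 ≤ c * F x ^ 2 by positivity)
      nlinarith
    rw [intervalIntegral.integral_sub (iA.add (iD.const_mul c)) (iB.const_mul _),
      intervalIntegral.integral_add iA (iD.const_mul c), intervalIntegral.integral_const_mul,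
      intervalIntegral.integral_const_mul, hD, hR R le_rfl] at hnn
    have h6 : 0 ≤ c * (F ε ^ 2 * P ε) :=
      mul_nonneg hc.le (mul_nonneg (sq_nonneg _) (hP0 ε he))
    have h7 : ∫ x in ε..R, deriv F x ^ 2 * w x ≤ ∫ x in Set.Ioi (0 : ℝ), deriv F x ^ 2 * w x := by
      rw [intervalIntegral.integral_of_le heR.le]
      exact setIntegral_mono_set hA hAnn
        (Filter.Eventually.of_forall fun x hx => lt_trans he hx.1)
    rw [← intervalIntegral.integral_of_le heR.le]
    nlinarith
  have hBR : ∫ x in Set.Ioi (0 : ℝ), F x ^ 2 * b x = ∫ x in Set.Ioc 0 R, F x ^ 2 * b x := by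
    refine setIntegral_eq_of_subset_of_forall_sdiff_eq_zero measurableSet_Ioi
      (fun x hx => hx.1) ?_
    intro x hx
    have : R ≤ x := by
      by_contra h
      exact hx.2 ⟨hx.1, (not_le.1 h).le⟩
    simp [hR x this]
  rw [hBR]
  have hlim : Filter.Tendsto (fun ε => ∫ x in Set.Ioc ε R, F x ^ 2 * b x) (nhdsWithin 0 (Set.Ioi 0))
      (nhds (∫ x in Set.Ioc 0 R, F x ^ 2 * b x)) := by
    have hcov : AECover (volume.restrict (Set.Ioc (0:ℝ) R)) (nhdsWithin (0:ℝ) (Set.Ioi 0))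
        (fun ε => Set.Ioc ε R) :=
      aecover_Ioc_of_Ioc (Filter.tendsto_id.mono_left nhdsWithin_le_nhds) tendsto_const_nhds
    have := hcov.integral_tendsto_of_countably_generated (f := fun x => F x ^ 2 * b x)
      (hB.mono_set fun x hx => hx.1)
    refine this.congr' ?_
    filter_upwards [self_mem_nhdsWithin] with ε he
    rw [Measure.restrict_restrict measurableSet_Ioc, Set.inter_eq_left.2]
    exact fun x hx => ⟨lt_trans he hx.1, hx.2⟩
  refine le_of_tendsto (hlim.const_mul (c ^ 2)) ?_
  filter_upwards [Ioo_mem_nhdsGT hR0] with ε he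
  exact key ε he.1 he.2

lemma sinh_le_mul_cosh' (x : ℝ) (hx : 0 ≤ x) : Real.sinh x ≤ x * Real.cosh x := by
  have hmono : MonotoneOn (fun x => x * Real.cosh x - Real.sinh x) (Set.Ici 0) := by
    have hd : ∀ x : ℝ, HasDerivAt (fun x => x * Real.cosh x - Real.sinh x)
        (1 * Real.cosh x + x * Real.sinh x - Real.cosh x) x := fun x =>
      ((hasDerivAt_id x).mul (Real.hasDerivAt_cosh x)).sub (Real.hasDerivAt_sinh x)
    refine monotoneOn_of_deriv_nonneg (convex_Ici 0) (by fun_prop) (by fun_prop) ?_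
    intro x hx
    rw [interior_Ici] at hx
    rw [(hd x).deriv]
    have := mul_nonneg (le_of_lt hx) (Real.sinh_nonneg_iff.2 (le_of_lt hx))
    linarith
  have := hmono (Set.self_mem_Ici) hx hx
  simp at this
  exact this

lemma hardy_int (n : ℕ) (hn : 3 ≤ n) (β : ℝ) (hβ : β < (n : ℝ) - 4)
    (F : ℝ → ℝ) (hF : ContDiff ℝ (⊤ : ℕ∞) F) (hFc : HasCompactSupport F)
    (hw : ContinuousOn (fun x : ℝ => x ^ (-β) * Real.sinh x ^ ((n : ℝ) - 3)) (Set.Ioi 0)) :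
    IntegrableOn (fun x => deriv F x ^ 2 * (x ^ (-β) * Real.sinh x ^ ((n : ℝ) - 3)))
      (Set.Ioi 0) := by
  have hF' : Continuous (deriv F) := hF.continuous_deriv (by simp)
  have hFc' : HasCompactSupport (deriv F) := hFc.deriv
  have hn' : (3:ℝ) ≤ n := by exact_mod_cast hn
  obtain ⟨R, hR0, hR⟩ : ∃ R : ℝ, 0 < R ∧ ∀ x, R ≤ x → deriv F x = 0 := by
    obtain ⟨r, hr⟩ := hFc'.isCompact.isBounded.subset_closedBall (0:ℝ)
    refine ⟨max r 0 + 1, by positivity, fun x hx => ?_⟩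
    by_contra h
    have := hr (subset_tsupport (deriv F) h)
    rw [Metric.mem_closedBall, dist_zero_right, Real.norm_eq_abs] at this
    have := le_abs_self x
    have := le_max_left r 0
    linarith
  obtain ⟨C, hC⟩ := hF'.bounded_above_of_compact_support hFc'
  have h1 : IntegrableOn (fun x => deriv F x ^ 2 * (x ^ (-β) * Real.sinh x ^ ((n : ℝ) - 3)))
      (Set.Ioc 0 R) := by
    refine IntegrableOn.of_bound (by simp) ?_
      (C ^ 2 * (R ^ ((n:ℝ) - 3 - β) * Real.cosh R ^ ((n:ℝ) - 3))) ?_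
    · exact (((hF'.pow 2).continuousOn.mul hw).mono (fun x hx => hx.1)).aestronglyMeasurable
        measurableSet_Ioc
    · filter_upwards [ae_restrict_mem measurableSet_Ioc] with x hx
      have hx0 : 0 < x := hx.1
      have hs : 0 < Real.sinh x := Real.sinh_pos_iff.2 hx0
      rw [Real.norm_of_nonneg (by positivity)]
      have hd : deriv F x ^ 2 ≤ C ^ 2 := by
        have := hC x
        rw [← sq_abs, ← Real.norm_eq_abs]
        gcongr
      have hch : Real.cosh x ≤ Real.cosh R := by
        rw [Real.cosh_le_cosh, abs_of_pos hx0, abs_of_pos hR0]; exact hx.2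
      have h2 : Real.sinh x ^ ((n:ℝ) - 3) ≤ x ^ ((n:ℝ) - 3) * Real.cosh R ^ ((n:ℝ) - 3) := by
        rw [← Real.mul_rpow hx0.le (Real.cosh_pos R).le]
        refine Real.rpow_le_rpow hs.le ?_ (by linarith)
        exact (sinh_le_mul_cosh' x hx0.le).trans (by gcongr)
      have h3 : x ^ (-β) * Real.sinh x ^ ((n:ℝ) - 3)
          ≤ R ^ ((n:ℝ) - 3 - β) * Real.cosh R ^ ((n:ℝ) - 3) := by
        calc _ ≤ x ^ (-β) * (x ^ ((n:ℝ) - 3) * Real.cosh R ^ ((n:ℝ) - 3)) := by gcongr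
          _ = x ^ ((n:ℝ) - 3 - β) * Real.cosh R ^ ((n:ℝ) - 3) := by
            rw [← mul_assoc, ← Real.rpow_add hx0]; congr 2; ring
          _ ≤ _ := by
            have := Real.rpow_le_rpow hx0.le hx.2 (show 0 ≤ (n:ℝ) - 3 - β by linarith)
            have := Real.cosh_pos R
            gcongr
      gcongr
  refine (IntegrableOn.of_forall_sdiff_eq_zero h1 measurableSet_Ioi ?_)
  intro x hx
  have : R ≤ x := by
    by_contra h
    exact hx.2 ⟨hx.1, (not_le.1 h).le⟩
  simp [hR x this]

lemma hardy_cts (β a : ℝ) :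
    ContinuousOn (fun x : ℝ => x ^ β * Real.sinh x ^ a) (Set.Ioi 0) := by
  intro x hx
  have hx : 0 < x := hx
  have hs : 0 < Real.sinh x := Real.sinh_pos_iff.2 hx
  refine ContinuousAt.continuousWithinAt ?_
  have h2 := Real.continuous_sinh.continuousAt.rpow_const (x := x) (p := a) (Or.inl hs.ne')
  exact (continuousAt_id.rpow_const (Or.inl hx.ne')).mul h2

/-- The one-dimensional weighted hyperbolic Hardy inequality (5.5)–(5.6) from the
proof of Theorem 5.2. -/
theorem hyperbolic_hardy_one_dim (n : ℕ) (hn : 3 ≤ n) (β : ℝ) (hβ : β < (n : ℝ) - 4)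
    (F : ℝ → ℝ) (hF : ContDiff ℝ (⊤ : ℕ∞) F) (hFc : HasCompactSupport F) :
    ∫ ρ in Set.Ioi (0 : ℝ), deriv F ρ ^ 2 * ρ ^ (-β) * Real.sinh ρ ^ ((n : ℝ) - 3) ≥
      (((n : ℝ) - β - 4) ^ 2 / 4) *
        ∫ ρ in Set.Ioi (0 : ℝ), F ρ ^ 2 * ρ ^ (-β) * Real.sinh ρ ^ ((n : ℝ) - 5) := by
  have hint := hardy_int n hn β hβ F hF hFc (hardy_cts _ _)
  have hc : 0 < ((n:ℝ) - β - 4) / 2 := by linarith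
  rw [show (((n : ℝ) - β - 4) ^ 2 / 4) = (((n : ℝ) - β - 4) / 2) ^ 2 by ring]
  simp only [mul_assoc]
  have hw0 : ∀ x : ℝ, 0 < x → 0 < x ^ (-β) * Real.sinh x ^ ((n : ℝ) - 3) := by
    intro x hx
    have hs : 0 < Real.sinh x := Real.sinh_pos_iff.2 hx
    positivity
  rcases hn.eq_or_lt with h3 | h4
  · subst h3
    refine hardy_core _ _ (fun x => x ^ (-β - 1))
      (fun x => (-β - 1) * x ^ (-β - 1 - 1)) F _ hc hF hFc (hardy_cts _ _) (hardy_cts _ _) ?_ ?_ hw0 ?_ ?_ hint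
    · have h := hardy_cts (-β - 1 - 1) 0
      simp only [Real.rpow_zero, mul_one] at h
      exact continuousOn_const.mul h
    · intro x hx
      exact Real.hasDerivAt_rpow_const (Or.inl hx.ne')
    · intro x hx; positivity
    · intro x hx
      have hs : 0 < Real.sinh x := Real.sinh_pos_iff.2 hx
      have h1 : x ≤ Real.sinh x := Real.self_le_sinh_iff.2 hx.le
      have hp : 0 < x ^ (-β) := by positivity
      rw [show (((3 : ℕ) : ℝ) - 3) = 0 by norm_num, Real.rpow_zero, mul_one,
        show (((3 : ℕ) : ℝ) - 5) = ((-2 : ℤ) : ℝ) by norm_num, Real.rpow_intCast,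
        Real.rpow_sub_one hx.ne' (-β - 1), Real.rpow_sub_one hx.ne' (-β)]
      have h2 : Real.sinh x ^ (-2 : ℤ) ≤ 1 / x ^ 2 := by
        rw [zpow_neg, ← one_div]
        exact one_div_le_one_div_of_le (by positivity) (by exact_mod_cast pow_le_pow_left₀ hx.le h1 2)
      have h5 : (x ^ (-β) / x) ^ 2 / x ^ (-β) = x ^ (-β) * (1 / x ^ 2) := by
        field_simp
      have h6 : x ^ (-β) / x / x = x ^ (-β) * (1 / x ^ 2) := by
        field_simp
      rw [h5, h6]
      push_cast at hc ⊢
      have h7 := mul_le_mul_of_nonneg_left (mul_le_mul_of_nonneg_left h2 hp.le) hc.le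
      linarith
  · have hn4 : (4:ℝ) ≤ n := by exact_mod_cast h4
    refine hardy_core _ _ (fun x => x ^ (-β) * Real.sinh x ^ ((n:ℝ) - 4))
      (fun x => (x ^ (-β) * Real.sinh x ^ ((n:ℝ) - 5)) * (((n:ℝ) - 4) * Real.cosh x - β * (Real.sinh x / x)))
      F _ hc hF hFc (hardy_cts _ _) (hardy_cts _ _) ?_ ?_ hw0 ?_ ?_ hint
    · refine (hardy_cts _ _).mul ?_
      refine ContinuousOn.sub (by fun_prop) (continuousOn_const.mul ?_)
      exact Real.continuous_sinh.continuousOn.div continuousOn_id (fun x hx => (ne_of_gt hx))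
    · intro x hx
      have hs : 0 < Real.sinh x := Real.sinh_pos_iff.2 hx
      have h1 := (Real.hasDerivAt_rpow_const (p := -β) (Or.inl hx.ne')).mul
        ((Real.hasDerivAt_sinh x).rpow_const (p := (n:ℝ) - 4) (Or.inl hs.ne'))
      refine HasDerivAt.congr_deriv h1 ?_
      rw [show (n:ℝ) - 4 - 1 = (n:ℝ) - 5 by ring, Real.rpow_sub_one hx.ne',
        show (n:ℝ) - 4 = ((n:ℝ) - 5) + 1 by ring, Real.rpow_add_one hs.ne']
      field_simp
      ring
    · intro x hx
      have hs : 0 < Real.sinh x := Real.sinh_pos_iff.2 hx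
      positivity
    · intro x hx
      have hs : 0 < Real.sinh x := Real.sinh_pos_iff.2 hx
      have h1 : 1 ≤ Real.sinh x / x := by
        rw [le_div_iff₀ hx, one_mul]; exact Real.self_le_sinh_iff.2 hx.le
      have h2 : Real.sinh x / x ≤ Real.cosh x := by
        rw [div_le_iff₀ hx, mul_comm]; exact sinh_le_mul_cosh' x hx.le
      have h3 : (x ^ (-β) * Real.sinh x ^ ((n:ℝ) - 4)) ^ 2 / (x ^ (-β) * Real.sinh x ^ ((n:ℝ) - 3))
          = x ^ (-β) * Real.sinh x ^ ((n:ℝ) - 5) := by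
        have e4 : Real.sinh x ^ ((n:ℝ) - 4) = Real.sinh x ^ ((n:ℝ) - 5) * Real.sinh x := by
          rw [← Real.rpow_add_one hs.ne']; congr 1; ring
        have e3 : Real.sinh x ^ ((n:ℝ) - 3) = Real.sinh x ^ ((n:ℝ) - 5) * Real.sinh x * Real.sinh x := by
          rw [← Real.rpow_add_one hs.ne', ← Real.rpow_add_one hs.ne']; congr 1; ring
        have hp : 0 < x ^ (-β) := by positivity
        have hq : 0 < Real.sinh x ^ ((n:ℝ) - 5) := by positivity
        rw [e4, e3]
        field_simp
      rw [h3]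
      have hb : 0 < x ^ (-β) * Real.sinh x ^ ((n:ℝ) - 5) := by positivity
      have h6 : (n:ℝ) - 4 - β ≤ ((n:ℝ) - 4) * Real.cosh x - β * (Real.sinh x / x) := by
        rcases le_total β 0 with h | h
        · nlinarith
        · nlinarith
      have := mul_le_mul_of_nonneg_left h6 hb.le
      linarith
end

section
/- Let n ≥ 3 and k ≥ 1 be integers and β a real number with −2 < β ≤ n − 4. Then for every ρ > 0, k(n+k−2) + (n−β−4)²/2 + 2 sinh²ρ + 2(n−4) cosh²ρ − β(β+1) (sinh²ρ)/ρ² + β(n−5) (sinh(2ρ))/(2ρ) ≥ 0. -/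
lemma hyp_coeff_aux (N β L : ℝ) (hN : 0 ≤ N) (hL : 1 ≤ L) (h1 : -2 < β) (h2 : β ≤ N - 1) :
    0 ≤ N - β * (β + 1) / ((L + 1) * (2 * L + 1)) + β * (N - 2) / (2 * L + 1) := by
  have e : N - β * (β + 1) / ((L + 1) * (2 * L + 1)) + β * (N - 2) / (2 * L + 1) =
      (N * (L + 1) * (2 * L + 1) - β * (β + 1) + β * (N - 2) * (L + 1)) /
        ((L + 1) * (2 * L + 1)) := by
    field_simp
  rw [e]
  apply div_nonneg _ (by positivity)
  -- concave in `β`: interpolate between the endpoints `-2` and `N - 1`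
  have p0 : 0 ≤ N * (L + 1) * (2 * L - 1) - 2 + 4 * (L + 1) := by
    have : 0 ≤ N * (L + 1) * (2 * L - 1) :=
      mul_nonneg (mul_nonneg hN (by linarith)) (by linarith)
    linarith
  have p1 : 0 ≤ N * (L + 1) * (2 * L + 1) - (N - 1) * N + (N - 1) * (N - 2) * (L + 1) := by
    obtain ⟨m, rfl⟩ : ∃ m, L = 1 + m := ⟨L - 1, by ring⟩
    have hm : 0 ≤ m := by linarith
    have q1 : 0 ≤ N * m := mul_nonneg hN hm
    have q2 : 0 ≤ N * m * m := mul_nonneg q1 hm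
    have q3 : 0 ≤ N ^ 2 * m := by positivity
    nlinarith [sq_nonneg N]
  have q : 0 ≤ (β + 2) * (N - 1 - β) := mul_nonneg (by linarith) (by linarith)
  have r0 := mul_nonneg (show 0 ≤ N - 1 - β by linarith) p0
  have r1 := mul_nonneg (show 0 ≤ β + 2 by linarith) p1
  have r2 := mul_nonneg q (show 0 ≤ N + 1 by linarith)
  have hp : 0 < N + 1 := by linarith
  refine nonneg_of_mul_nonneg_right ?_ hp
  nlinarith

/-- Inequality (5.9) in the proof of Theorem 5.2, with `c_k = k(n+k-2)` the `k`-th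
eigenvalue of the Laplace–Beltrami operator on the unit sphere `S^{n-1}`. -/
theorem hyperbolic_coefficient_nonneg (n k : ℕ) (hn : 3 ≤ n) (hk : 1 ≤ k) (β : ℝ)
    (hβl : -2 < β) (hβu : β ≤ (n : ℝ) - 4) (ρ : ℝ) (hρ : 0 < ρ) :
    0 ≤ (k : ℝ) * ((n : ℝ) + k - 2) + ((n : ℝ) - β - 4) ^ 2 / 2 +
        2 * Real.sinh ρ ^ 2 + 2 * ((n : ℝ) - 4) * Real.cosh ρ ^ 2 -
        β * (β + 1) * (Real.sinh ρ ^ 2 / ρ ^ 2) +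
        β * ((n : ℝ) - 5) * (Real.sinh (2 * ρ) / (2 * ρ)) := by
  have hx : 2 * ρ ≠ 0 := by positivity
  have hC := Real.hasSum_cosh (2 * ρ)
  have hS := (Real.hasSum_sinh (2 * ρ)).div_const (2 * ρ)
  have hQ := (((hasSum_nat_add_iff' 1).2 hC).mul_left 2).div_const ((2 * ρ) ^ 2)
  have hI := hasSum_ite_eq (0 : ℕ)
    ((k : ℝ) * ((n : ℝ) + k - 2) + ((n : ℝ) - β - 4) ^ 2 / 2 - 1 + ((n : ℝ) - 4))
  have hT := ((hI.add (hC.mul_left ((n : ℝ) - 3))).sub (hQ.mul_left (β * (β + 1)))).add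
    (hS.mul_left (β * ((n : ℝ) - 5)))
  have hc : Real.cosh (2 * ρ) = 2 * Real.sinh ρ ^ 2 + 1 := by
    rw [Real.cosh_two_mul, Real.cosh_sq]; ring
  have hn' : (3 : ℝ) ≤ n := by exact_mod_cast hn
  have hk' : (1 : ℝ) ≤ k := by exact_mod_cast hk
  have key := hT.nonneg ?_
  · refine key.trans_eq (Eq.symm ?_)
    simp only [Finset.sum_range_one, hc, Real.cosh_sq]
    norm_num
    field_simp
    ring
  · intro l
    have e : ∀ A : ℝ, A + ((n : ℝ) - 3) * ((2 * ρ) ^ (2 * l) / ((2 * l).factorial : ℝ)) -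
        β * (β + 1) * (2 * ((2 * ρ) ^ (2 * (l + 1)) / ((2 * (l + 1)).factorial : ℝ))
          / (2 * ρ) ^ 2) +
        β * ((n : ℝ) - 5) * ((2 * ρ) ^ (2 * l + 1) / ((2 * l + 1).factorial : ℝ) / (2 * ρ)) =
        A + (((n : ℝ) - 3) - β * (β + 1) / (((l : ℝ) + 1) * (2 * l + 1)) +
          β * (((n : ℝ) - 3) - 2) / (2 * l + 1)) *
          ((2 * ρ) ^ (2 * l) / ((2 * l).factorial : ℝ)) := by
      intro A
      have f1 : ((2 * l + 1).factorial : ℝ) = (2 * l + 1) * ((2 * l).factorial : ℝ) := by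
        rw [Nat.factorial_succ]; push_cast; ring
      have f2 : ((2 * (l + 1)).factorial : ℝ) =
          2 * (l + 1) * ((2 * l + 1) * ((2 * l).factorial : ℝ)) := by
        rw [show 2 * (l + 1) = (2 * l + 1) + 1 by ring, Nat.factorial_succ]
        push_cast [f1]; ring
      have f3 : ((2 * l).factorial : ℝ) ≠ 0 := by positivity
      have g1 : (2 * ρ) ^ (2 * (l + 1)) = (2 * ρ) ^ (2 * l) * (2 * ρ) ^ 2 := by
        rw [← pow_add]; ring_nf
      rw [f1, f2, g1, pow_succ (2 * ρ) (2 * l)]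
      generalize (2 * ρ) ^ (2 * l) = P
      field_simp
      ring
    show (0 : ℝ) ≤ _
    rw [e]
    rcases Nat.eq_zero_or_pos l with rfl | hl
    · simp
      have hk2 : (0 : ℝ) ≤ (k : ℝ) * (n + k - 2) := by
        apply mul_nonneg <;> linarith
      have hb : 0 ≤ ((n : ℝ) - 2 - (β + 2)) * ((n : ℝ) - 2 + (β + 2)) := by
        apply mul_nonneg <;> linarith
      nlinarith
    · rw [if_neg (by omega), zero_add]
      apply mul_nonneg _ (by positivity)
      exact hyp_coeff_aux _ _ _ (by linarith) (by exact_mod_cast hl) hβl (by linarith)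
end
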